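/- arXiv:1609.06025 — 4 statements merged into one kernel-verified Lean document; each statement's English description precedes it below -/
import Mathlib

section
/- The map E from the polynomial ring 𝕂[X₁,…,Xₙ,U₁,…,Uₙ] to the ring of real-valued functions on ℝⁿ, sending P to the function x ↦ P(x₁,…,xₙ, e^{x₁},…,e^{xₙ}), is an injective ring homomorphism; consequently E is a ring isomorphism from 𝕂[X₁,…,Xₙ,U₁,…,Uₙ] onto the ring 𝕂[X, e^X] of exponential polynomials. -/
open MeasureTheory Set
open scoped ENNReal

noncomputable section

/-- `K` is a real algebraic extension of `ℚ`: every element of `K` is algebraic over `ℚ`. -/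
def RealAlgExt (K : Subfield ℝ) : Prop := ∀ a : K, IsAlgebraic ℚ (a : ℝ)

/-- A real polynomial has all its coefficients in the subfield `K` of `ℝ`. -/
def CoeffsIn {σ : Type*} (K : Subfield ℝ) (P : MvPolynomial σ ℝ) : Prop :=
  ∀ m, P.coeff m ∈ K

/-- Evaluation of a polynomial in `X₁,…,Xₙ,U₁,…,Uₙ` at `(x, e^x)`:
the E-polynomial associated to `P`. -/
def expEval {n : ℕ} (P : MvPolynomial (Fin n ⊕ Fin n) ℝ) (x : Fin n → ℝ) : ℝ :=
  MvPolynomial.eval (Sum.elim x fun i => Real.exp (x i)) P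

/-- Exponential sets over `K` in `ℝⁿ`: zero sets of E-polynomials over `K`. -/
def IsExpSet {n : ℕ} (K : Subfield ℝ) (V : Set (Fin n → ℝ)) : Prop :=
  ∃ P : MvPolynomial (Fin n ⊕ Fin n) ℝ, CoeffsIn K P ∧ V = {x | expEval P x = 0}

/-- Real algebraic sets over `K` (in coordinates indexed by `σ`). -/
def IsAlgSet {σ : Type*} (K : Subfield ℝ) (S : Set (σ → ℝ)) : Prop :=
  ∃ P : MvPolynomial σ ℝ, CoeffsIn K P ∧ S = {x | MvPolynomial.eval x P = 0}

/-- An exponential set is irreducible if it is nonempty and is not the union of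
two proper exponential subsets. -/
def IsIrredExpSet {n : ℕ} (K : Subfield ℝ) (V : Set (Fin n → ℝ)) : Prop :=
  IsExpSet K V ∧ V.Nonempty ∧
    ¬ ∃ V₁ V₂ : Set (Fin n → ℝ),
      IsExpSet K V₁ ∧ IsExpSet K V₂ ∧ V = V₁ ∪ V₂ ∧ V₁ ⊂ V ∧ V₂ ⊂ V

/-- `T` is an irreducible component of `V`: a maximal irreducible exponential subset of `V`. -/
def IsExpComponent {n : ℕ} (K : Subfield ℝ) (T V : Set (Fin n → ℝ)) : Prop :=
  IsIrredExpSet K T ∧ T ⊆ V ∧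
    ∀ T', IsIrredExpSet K T' → T ⊆ T' → T' ⊆ V → T' = T

/-- A real algebraic set is irreducible over `K` if it is nonempty and is not the union of
two proper algebraic subsets over `K`. -/
def IsIrredAlgSet {σ : Type*} (K : Subfield ℝ) (V : Set (σ → ℝ)) : Prop :=
  IsAlgSet K V ∧ V.Nonempty ∧
    ¬ ∃ V₁ V₂ : Set (σ → ℝ),
      IsAlgSet K V₁ ∧ IsAlgSet K V₂ ∧ V = V₁ ∪ V₂ ∧ V₁ ⊂ V ∧ V₂ ⊂ V

/-- `T` is an irreducible component over `K` of the real algebraic set `V`. -/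
def IsAlgComponent {σ : Type*} (K : Subfield ℝ) (T V : Set (σ → ℝ)) : Prop :=
  IsIrredAlgSet K T ∧ T ⊆ V ∧
    ∀ T', IsIrredAlgSet K T' → T ⊆ T' → T' ⊆ V → T' = T

/-- Local (Hausdorff) dimension of `A` at `x`. -/
def locDim {n : ℕ} (A : Set (Fin n → ℝ)) (x : Fin n → ℝ) : ℝ≥0∞ :=
  ⨅ (ε : ℝ) (_ : 0 < ε), dimH (A ∩ Metric.ball x ε)

/-- `A_p`: the set of points of `A` at which `A` has local dimension `p`. -/
def localSet {n : ℕ} (A : Set (Fin n → ℝ)) (p : ℕ) : Set (Fin n → ℝ) :=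
  {x | x ∈ A ∧ locDim A x = (p : ℝ≥0∞)}

/-- The exponent vectors of the `U`-monomials of `P` (with nonzero coefficient in `𝕂[X]`). -/
def Uexps {n : ℕ} (P : MvPolynomial (Fin n ⊕ Fin n) ℝ) : Set (Fin n → ℕ) :=
  (fun (m : (Fin n ⊕ Fin n) →₀ ℕ) (i : Fin n) => m (Sum.inr i)) '' (P.support : Set _)

/-- The union `W_P` of the linear hyperplane sets associated to pairs of distinct
`U`-monomials of `P`. -/
def WP {n : ℕ} (P : MvPolynomial (Fin n ⊕ Fin n) ℝ) : Set (Fin n → ℝ) :=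
  {x | ∃ d e : Fin n → ℕ, d ∈ Uexps P ∧ e ∈ Uexps P ∧ d ≠ e ∧
    ∑ i, (d i : ℝ) * x i = ∑ i, (e i : ℝ) * x i}

/-- Schanuel's conjecture over the reals, with "the transcendence degree of
`ℚ(x₁,…,xₙ,e^{x₁},…,e^{xₙ})` over `ℚ` is less than `n`" expressed as: no `n`-tuple of
elements of `{x₁,…,xₙ,e^{x₁},…,e^{xₙ}}` is algebraically independent over `ℚ`. -/
def SchanuelConjecture : Prop :=
  ∀ (n : ℕ) (x : Fin n → ℝ),
    (¬ ∃ v : Fin n → ℝ,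
        (∀ i, v i ∈ Set.range x ∪ Set.range fun j => Real.exp (x j)) ∧
        AlgebraicIndependent ℚ v) →
    ∃ m : Fin n → ℤ, (∃ i, m i ≠ 0) ∧ ∑ i, (m i : ℝ) * x i = 0


/-- The map `E` from `𝕂[X₁,…,Xₙ,U₁,…,Uₙ]` to functions `ℝⁿ → ℝ`,
sending `P` to `x ↦ P(x, e^x)`, as a ring homomorphism. -/
def Emap (n : ℕ) (K : Subfield ℝ) :
    MvPolynomial (Fin n ⊕ Fin n) K →+* ((Fin n → ℝ) → ℝ) :=
  Pi.ringHom fun x => MvPolynomial.eval₂Hom K.subtype (Sum.elim x fun i => Real.exp (x i))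

/-- A polynomial in finitely many variables that vanishes along the real curve `t ↦ (t, exp t)` in
the coordinates `j` and `k` vanishes at all pairs `(a, exp b)` in these coordinates. -/
lemma MvPolynomial.eval_update_update_exp_eq_zero {σ : Type*} [Finite σ] [DecidableEq σ]
    (P : MvPolynomial σ ℂ) (v : σ → ℂ) (j k : σ)
    (h : ∀ t : ℝ, eval (Function.update (Function.update v j (t : ℂ)) k (Complex.exp t)) P = 0)
    (a b : ℂ) :
    eval (Function.update (Function.update v j a) k (Complex.exp b)) P = 0 := by
  have := Fintype.ofFinite σ
  have hg : Differentiable ℂ fun w : ℂ =>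
      eval (Function.update (Function.update v j w) k (Complex.exp w)) P := by
    simp only [MvPolynomial.eval_eq']
    refine Differentiable.fun_sum fun m _ => (differentiable_const _).mul ?_
    refine Differentiable.fun_finsetProd fun i _ => Differentiable.fun_pow ?_ _
    by_cases hik : i = k
    · subst hik; simp [Complex.differentiable_exp]
    · by_cases hij : i = j
      · subst hij; simp [Function.update_of_ne hik]
      · simp [Function.update_of_ne hik, Function.update_of_ne hij]
  have hzero : ∀ w : ℂ,
      eval (Function.update (Function.update v j w) k (Complex.exp w)) P = 0 := by
    have hfreq : ∃ᶠ w : ℂ in nhdsWithin 0 {0}ᶜ,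
        eval (Function.update (Function.update v j w) k (Complex.exp w)) P = (0 : ℂ → ℂ) w := by
      have ht : Filter.Tendsto (fun t : ℝ => (t : ℂ)) (nhdsWithin 0 {0}ᶜ)
          (nhdsWithin 0 {0}ᶜ) := by
        refine tendsto_nhdsWithin_iff.2 ⟨?_, ?_⟩
        · exact (Complex.continuous_ofReal.tendsto' 0 0 (by simp)).mono_left nhdsWithin_le_nhds
        · filter_upwards [self_mem_nhdsWithin] with t ht using by simpa using ht
      exact ht.frequently (Filter.Frequently.of_forall fun t => h t)
    exact fun w => congrFun (AnalyticOnNhd.eq_of_frequently_eq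
      (fun z _ => hg.analyticAt z) (fun z _ => analyticAt_const) hfreq) w
  let q : Polynomial ℂ :=
    aeval (Function.update (Function.update (fun i => Polynomial.C (v i)) j Polynomial.X) k
      (Polynomial.C (Complex.exp b))) P
  have hq : ∀ w : ℂ,
      q.eval w = eval (Function.update (Function.update v j w) k (Complex.exp b)) P := by
    intro w
    simp only [q]
    rw [← Polynomial.coe_evalRingHom, MvPolynomial.aeval_def, MvPolynomial.eval₂_comp_left,
      ← MvPolynomial.eval₂_id]
    congr 1
    · ext z; simp
    · ext i
      simp only [Function.comp_apply, Function.update_apply]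
      split_ifs <;> simp
  have hq0 : q = 0 := by
    refine Polynomial.eq_zero_of_infinite_isRoot q ?_
    refine (Set.infinite_range_of_injective
      (f := fun m : ℤ => b + m * (2 * Real.pi * Complex.I)) ?_).mono ?_
    · intro m m' hm
      simpa [Real.pi_ne_zero] using hm
    · rintro _ ⟨m, rfl⟩
      have := hzero (b + m * (2 * Real.pi * Complex.I))
      rw [Complex.exp_add, Complex.exp_int_mul_two_pi_mul_I, mul_one] at this
      simpa [Polynomial.IsRoot, hq] using this
  rw [← hq, hq0, Polynomial.eval_zero]

/-- A complex polynomial in `x` and `exp x` that vanishes at all real points is zero. -/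
lemma MvPolynomial.eq_zero_of_eval_sumElim_exp_eq_zero {ι : Type*} [Finite ι]
    (P : MvPolynomial (ι ⊕ ι) ℂ)
    (h : ∀ x : ι → ℝ, eval (Sum.elim (fun i => (x i : ℂ)) fun i => Complex.exp (x i)) P = 0) :
    P = 0 := by
  classical
  have := Fintype.ofFinite ι
  have key : ∀ s : Finset ι, ∀ x y : ι → ℝ, (∀ i ∉ s, y i = x i) →
      eval (Sum.elim (fun i => (x i : ℂ)) fun i => Complex.exp (y i)) P = 0 := by
    intro s
    induction s using Finset.induction_on with
    | empty =>
      intro x y hxy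
      obtain rfl : y = x := _root_.funext fun i => hxy i (Finset.notMem_empty i)
      exact h y
    | insert i s _ ih =>
      intro x y hxy
      have := MvPolynomial.eval_update_update_exp_eq_zero P
        (Sum.elim (fun i => (x i : ℂ)) fun i => Complex.exp (y i))
        (Sum.inl i) (Sum.inr i) (fun t => ?_) (x i) (y i)
      · convert this using 3
        refine _root_.funext ?_
        rintro (l | l) <;> rcases eq_or_ne l i with rfl | hl <;> simp [*]
      · convert ih (Function.update x i t) (Function.update y i t) ?_ using 3
        · refine _root_.funext ?_
          rintro (l | l) <;>
            simp only [Sum.elim_inl, Sum.elim_inr, Function.update_apply, Sum.inl.injEq,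
              Sum.inr.injEq, reduceCtorEq, if_false] <;> split_ifs <;> rfl
        · intro l hl
          by_cases hli : l = i
          · simp [hli]
          · simpa [hli] using hxy l (by simp [hli, hl])
  refine MvPolynomial.funext_set (Sum.elim (fun _ => Set.range fun t : ℝ => (t : ℂ))
    fun _ => Set.range fun t : ℝ => Complex.exp t) ?_ ?_
  · rintro (i | i)
    · exact Set.infinite_range_of_injective Complex.ofReal_injective
    · refine Set.infinite_range_of_injective fun s t hst => ?_
      simpa [← Complex.ofReal_exp] using hst
  · intro v hv
    choose x hx using fun i => hv (Sum.inl i) (Set.mem_univ _)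
    choose y hy using fun i => hv (Sum.inr i) (Set.mem_univ _)
    rw [map_zero, ← key Finset.univ x y (by simp)]
    congr 2
    refine _root_.funext ?_
    rintro (l | l) <;> simp [hx, hy]

/-- The map sending a polynomial to its associated exponential polynomial is injective. -/
lemma Emap_injective (n : ℕ) (K : Subfield ℝ) : Function.Injective (Emap n K) := by
  rw [injective_iff_map_eq_zero]
  intro P hP
  have hinj : Function.Injective (Complex.ofRealHom.comp K.subtype) := RingHom.injective _
  refine MvPolynomial.map_injective _ hinj ?_
  rw [map_zero]
  refine MvPolynomial.eq_zero_of_eval_sumElim_exp_eq_zero _ fun x => ?_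
  have hx : Complex.ofRealHom
      (MvPolynomial.eval₂ K.subtype (Sum.elim x fun i => Real.exp (x i)) P) = 0 := by
    rw [show MvPolynomial.eval₂ K.subtype (Sum.elim x fun i => Real.exp (x i)) P = 0 from
      congrFun hP x, map_zero]
  rw [MvPolynomial.eval₂_comp_left] at hx
  rw [MvPolynomial.eval_map, ← hx]
  congr 1
  refine funext ?_
  rintro (l | l) <;> simp

/-- `E` is an injective ring homomorphism; consequently it is a ring isomorphism
from `𝕂[X₁,…,Xₙ,U₁,…,Uₙ]` onto its image, the ring `𝕂[X, e^X]` of exponential polynomials. -/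
theorem stmt0 (n : ℕ) (K : Subfield ℝ) (hK : RealAlgExt K) :
    Function.Injective (Emap n K) ∧
    ∃ e : MvPolynomial (Fin n ⊕ Fin n) K ≃+* (Emap n K).range,
      ∀ P : MvPolynomial (Fin n ⊕ Fin n) K,
        ((e P : (Emap n K).range) : (Fin n → ℝ) → ℝ) = Emap n K P := by
  exact ⟨Emap_injective n K, RingEquiv.ofBijective (Emap n K).rangeRestrict
    ⟨fun _ _ h => Emap_injective n K (congrArg Subtype.val h),
      (Emap n K).rangeRestrict_surjective⟩, fun _ => rfl⟩

end
end

section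
/- The family of exponential sets over 𝕂 in ℝⁿ is the family of closed sets of a topology on ℝⁿ: it contains ∅ and ℝⁿ, and it is closed under finite unions and under arbitrary intersections. Moreover, this topology (the Zariski topology on ℝⁿ) is Noetherian: every descending chain of exponential sets over 𝕂 stabilizes after finitely many steps. -/
open MeasureTheory Set
open scoped ENNReal

noncomputable section

/-- Evaluation at `(x, e^x)`, as an algebra homomorphism on polynomials over `K`. -/
def expAeval {n : ℕ} (K : Subfield ℝ) (x : Fin n → ℝ) :
    MvPolynomial (Fin n ⊕ Fin n) K →ₐ[K] ℝ :=
  MvPolynomial.aeval (Sum.elim x fun i => Real.exp (x i))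

theorem expEval_map {n : ℕ} (K : Subfield ℝ) (p : MvPolynomial (Fin n ⊕ Fin n) K)
    (x : Fin n → ℝ) : expEval (MvPolynomial.map (algebraMap K ℝ) p) x = expAeval K x p := by
  simp only [expEval, expAeval, MvPolynomial.eval_map, MvPolynomial.aeval_def]

theorem isExpSet_iff {n : ℕ} {K : Subfield ℝ} {V : Set (Fin n → ℝ)} :
    IsExpSet K V ↔
      ∃ p : MvPolynomial (Fin n ⊕ Fin n) K, V = {x | expAeval K x p = 0} := by
  constructor
  · rintro ⟨P, hP, rfl⟩
    have hmem : P ∈ Set.range (MvPolynomial.map (σ := Fin n ⊕ Fin n) (algebraMap K ℝ)) := by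
      rw [MvPolynomial.mem_range_map_iff_coeffs_subset]
      rintro c hc
      obtain ⟨m, -, rfl⟩ := MvPolynomial.mem_coeffs_iff.mp hc
      exact ⟨⟨_, hP m⟩, rfl⟩
    obtain ⟨p, rfl⟩ := hmem
    exact ⟨p, by simp only [expEval_map]⟩
  · rintro ⟨p, rfl⟩
    refine ⟨MvPolynomial.map (algebraMap K ℝ) p, fun m => ?_, by simp only [expEval_map]⟩
    rw [MvPolynomial.coeff_map]
    exact (p.coeff m).2

/-- The ideal of polynomials over `K` whose E-polynomials vanish on `V`. -/
def expIdeal {n : ℕ} (K : Subfield ℝ) (V : Set (Fin n → ℝ)) :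
    Ideal (MvPolynomial (Fin n ⊕ Fin n) K) :=
  ⨅ x ∈ V, RingHom.ker (expAeval K x)

theorem mem_expIdeal {n : ℕ} {K : Subfield ℝ} {V : Set (Fin n → ℝ)}
    {p : MvPolynomial (Fin n ⊕ Fin n) K} :
    p ∈ expIdeal K V ↔ ∀ x ∈ V, expAeval K x p = 0 := by
  simp only [expIdeal, Ideal.mem_iInf, RingHom.mem_ker]

theorem expIdeal_anti {n : ℕ} (K : Subfield ℝ) {V W : Set (Fin n → ℝ)} (h : V ⊆ W) :
    expIdeal K W ≤ expIdeal K V :=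
  fun _ hp => mem_expIdeal.mpr fun x hx => mem_expIdeal.mp hp x (h hx)

/-- The common zero set of the E-polynomials of an ideal is the zero set of one E-polynomial:
a sum of squares of generators. -/
theorem isExpSet_zeros_ideal {n : ℕ} {K : Subfield ℝ}
    (I : Ideal (MvPolynomial (Fin n ⊕ Fin n) K)) :
    IsExpSet K {x : Fin n → ℝ | ∀ p ∈ I, expAeval K x p = 0} := by
  obtain ⟨s, rfl⟩ := (isNoetherianRing_iff_ideal_fg _).mp inferInstance I
  refine isExpSet_iff.mpr ⟨∑ p ∈ s, p ^ 2, ?_⟩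
  ext x
  have hspan : (∀ p ∈ Ideal.span (s : Set (MvPolynomial (Fin n ⊕ Fin n) K)),
      expAeval K x p = 0) ↔ ∀ p ∈ s, expAeval K x p = 0 :=
    Ideal.span_le (I := RingHom.ker (expAeval K x))
  rw [mem_ofPred_eq, mem_ofPred_eq, hspan, map_sum]
  simp only [map_pow]
  rw [Finset.sum_eq_zero_iff_of_nonneg fun p _ => sq_nonneg _]
  simp only [sq_eq_zero_iff]

theorem IsExpSet.eq_zeros_expIdeal {n : ℕ} {K : Subfield ℝ} {V : Set (Fin n → ℝ)}
    (hV : IsExpSet K V) : V = {x | ∀ p ∈ expIdeal K V, expAeval K x p = 0} := by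
  refine Subset.antisymm (fun x hx p hp => mem_expIdeal.mp hp x hx) fun x hx => ?_
  obtain ⟨p, hp⟩ := isExpSet_iff.mp hV
  rw [hp]
  exact hx p (mem_expIdeal.mpr fun y hy => by rwa [hp] at hy)

theorem isExpSet_sInter {n : ℕ} {K : Subfield ℝ} {𝒮 : Set (Set (Fin n → ℝ))}
    (h : ∀ V ∈ 𝒮, IsExpSet K V) : IsExpSet K (⋂₀ 𝒮) := by
  convert isExpSet_zeros_ideal (expIdeal K (⋂₀ 𝒮)) using 1
  refine Subset.antisymm (fun x hx p hp => mem_expIdeal.mp hp x hx) fun x hx V hV => ?_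
  rw [(h V hV).eq_zeros_expIdeal]
  exact fun p hp => hx p (expIdeal_anti K (sInter_subset_of_mem hV) hp)

theorem IsExpSet.union {n : ℕ} {K : Subfield ℝ} {V W : Set (Fin n → ℝ)}
    (hV : IsExpSet K V) (hW : IsExpSet K W) : IsExpSet K (V ∪ W) := by
  obtain ⟨p, rfl⟩ := isExpSet_iff.mp hV
  obtain ⟨q, rfl⟩ := isExpSet_iff.mp hW
  refine isExpSet_iff.mpr ⟨p * q, ?_⟩
  ext x
  simp only [mem_union, mem_ofPred_eq, map_mul, mul_eq_zero]

theorem expSet_chain_stabilizes {n : ℕ} {K : Subfield ℝ} {C : ℕ → Set (Fin n → ℝ)}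
    (hC : ∀ i, IsExpSet K (C i)) (hanti : Antitone C) : ∃ N, ∀ m, N ≤ m → C m = C N := by
  obtain ⟨N, hN⟩ := monotone_stabilizes_iff_noetherian.mpr
    (inferInstance : IsNoetherianRing (MvPolynomial (Fin n ⊕ Fin n) K))
    ⟨fun i => expIdeal K (C i), fun i j hij => expIdeal_anti K (hanti hij)⟩
  refine ⟨N, fun m hm => ?_⟩
  have hideal : expIdeal K (C N) = expIdeal K (C m) := hN m hm
  rw [(hC m).eq_zeros_expIdeal, (hC N).eq_zeros_expIdeal, hideal]

/-- The exponential sets over `𝕂` in `ℝⁿ` are the closed sets of a topology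
(the Zariski topology), and this topology is Noetherian. -/
theorem stmt3 (n : ℕ) (K : Subfield ℝ) (hK : RealAlgExt K) :
    IsExpSet K (∅ : Set (Fin n → ℝ)) ∧
    IsExpSet K (Set.univ : Set (Fin n → ℝ)) ∧
    (∀ V₁ V₂ : Set (Fin n → ℝ), IsExpSet K V₁ → IsExpSet K V₂ → IsExpSet K (V₁ ∪ V₂)) ∧
    (∀ 𝒮 : Set (Set (Fin n → ℝ)), (∀ V ∈ 𝒮, IsExpSet K V) → IsExpSet K (⋂₀ 𝒮)) ∧
    (∀ C : ℕ → Set (Fin n → ℝ), (∀ i, IsExpSet K (C i)) → (∀ i, C (i + 1) ⊆ C i) →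
      ∃ N, ∀ m, N ≤ m → C m = C N) := by
  refine ⟨isExpSet_iff.mpr ⟨1, by simp⟩, isExpSet_iff.mpr ⟨0, by simp⟩,
    fun _ _ => IsExpSet.union, fun _ => isExpSet_sInter, fun C hC hstep => ?_⟩
  exact expSet_chain_stabilizes hC (antitone_nat_of_succ_le hstep)

end
end

section
/- For every P ∈ 𝕂[X₁,…,Xₙ,U₁] with associated exponential set V = {x ∈ ℝⁿ : P(x, e^{x₁}) = 0}, there exists a real algebraic set W ⊆ ℝ^{n+1} over 𝕂 that is admissible for V. -/
open MeasureTheory Set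
open scoped ENNReal

noncomputable section

/-- Evaluation of `P ∈ 𝕂[X₁,…,Xₙ,U₁]` at `(x, e^{x₁})`. -/
def expEval1 {n : ℕ} (hn : 0 < n) (P : MvPolynomial (Fin n ⊕ Unit) ℝ) (x : Fin n → ℝ) : ℝ :=
  MvPolynomial.eval (Sum.elim x fun _ => Real.exp (x ⟨0, hn⟩)) P

/-- The projection `π : ℝ^{n+1} → ℝⁿ` along the coordinate `U₁`. -/
def proj1 {n : ℕ} (z : (Fin n ⊕ Unit) → ℝ) : Fin n → ℝ := fun i => z (Sum.inl i)

/-- The graph `Γ = {(x,u₁) : u₁ = e^{x₁}}` in `ℝ^{n+1}`. -/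
def Gamma1 {n : ℕ} (hn : 0 < n) : Set ((Fin n ⊕ Unit) → ℝ) :=
  {z | z (Sum.inr ()) = Real.exp (z (Sum.inl ⟨0, hn⟩))}

/-- `W ⊆ ℝ^{n+1}` is admissible for `V`:
`W` is algebraic over `K`, `V = π((W ∩ Γ) ∪ Z(P, X₁, U₁ - 1))` and `dim W ≤ dim V + 1`. -/
def Admissible {n : ℕ} (hn : 0 < n) (K : Subfield ℝ) (P : MvPolynomial (Fin n ⊕ Unit) ℝ)
    (V : Set (Fin n → ℝ)) (W : Set ((Fin n ⊕ Unit) → ℝ)) : Prop :=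
  IsAlgSet K W ∧
  V = proj1 '' ((W ∩ Gamma1 hn) ∪
      {z | MvPolynomial.eval z P = 0 ∧ z (Sum.inl ⟨0, hn⟩) = 0 ∧ z (Sum.inr ()) = 1}) ∧
  dimH W ≤ dimH V + 1

section

open scoped Topology

/-- Evaluation at `(y, t)` of a polynomial in one variable over `K[Y]`. -/
def biEval {K ι : Type*} [Field K] [Algebra K ℝ] (q : Polynomial (MvPolynomial ι K))
    (y : ι → ℝ) (t : ℝ) : ℝ :=
  q.eval₂ (MvPolynomial.aeval y : MvPolynomial ι K →ₐ[K] ℝ).toRingHom t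

theorem contDiff_aeval {K ι : Type*} [Field K] [Algebra K ℝ] [Fintype ι]
    (f : MvPolynomial ι K) : ContDiff ℝ 1 fun y : ι → ℝ => MvPolynomial.aeval y f := by
  induction f using MvPolynomial.induction_on with
  | C a => simpa using contDiff_const
  | add p q hp hq => simpa using hp.add hq
  | mul_X p i hp => simpa using hp.mul (contDiff_apply ℝ ℝ i)

theorem contDiff_biEval {K ι : Type*} [Field K] [Algebra K ℝ] [Fintype ι]
    (q : Polynomial (MvPolynomial ι K)) :
    ContDiff ℝ 1 fun v : (ι → ℝ) × ℝ => biEval q v.1 v.2 := by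
  induction q using Polynomial.induction_on' with
  | add p q hp hq => simpa [biEval, Polynomial.eval₂_add] using hp.add hq
  | monomial k a =>
    simpa [biEval] using ((contDiff_aeval a).comp contDiff_fst).mul (contDiff_snd.pow k)

theorem hasDerivAt_biEval {K ι : Type*} [Field K] [Algebra K ℝ]
    (q : Polynomial (MvPolynomial ι K)) (y : ι → ℝ) (t : ℝ) :
    HasDerivAt (biEval q y) (biEval q.derivative y t) t := by
  have h := (q.map (MvPolynomial.aeval y : MvPolynomial ι K →ₐ[K] ℝ).toRingHom).hasDerivAt t
  simp only [Polynomial.derivative_map, Polynomial.eval_map] at h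
  exact h

/-- A simple root of a polynomial depends locally on the coefficients in a Lipschitz way. -/
theorem exists_lipschitz_root {K ι : Type*} [Field K] [Algebra K ℝ] [Fintype ι]
    (q : Polynomial (MvPolynomial ι K)) {y₀ : ι → ℝ} {t₀ : ℝ} (h₀ : biEval q y₀ t₀ = 0)
    (h₁ : biEval q.derivative y₀ t₀ ≠ 0) :
    ∃ (τ : (ι → ℝ) → ℝ) (C : NNReal), ∃ s ∈ 𝓝 y₀, LipschitzOnWith C τ s ∧ τ y₀ = t₀ ∧
      (∀ y ∈ s, biEval q y (τ y) = 0) ∧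
      ∀ᶠ v in 𝓝 (y₀, t₀), biEval q v.1 v.2 = 0 → τ v.1 = v.2 := by
  have hd := (contDiff_biEval q).hasStrictFDerivAt (x := (y₀, t₀)) one_ne_zero
  set f := fun v : (ι → ℝ) × ℝ => biEval q v.1 v.2
  have hpart : fderiv ℝ f (y₀, t₀) ∘L .inr ℝ (ι → ℝ) ℝ
      = ContinuousLinearMap.toSpanSingleton ℝ (biEval q.derivative y₀ t₀) := by
    have h2 : HasFDerivAt (fun t : ℝ => (y₀, t)) (.inr ℝ (ι → ℝ) ℝ) t₀ :=
      hasFDerivAt_prodMk_right y₀ t₀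
    have h3 := HasFDerivAt.comp (g := f) t₀ hd.hasFDerivAt h2
    exact h3.unique (hasDerivAt_biEval q y₀ t₀).hasFDerivAt
  have hinv : (fderiv ℝ f (y₀, t₀) ∘L .inr ℝ (ι → ℝ) ℝ).IsInvertible := by
    rw [hpart]
    exact ⟨ContinuousLinearEquiv.unitsEquivAut ℝ (Units.mk0 _ h₁), by ext; simp⟩
  obtain ⟨C, s, hs, hC⟩ :=
    (hd.hasStrictFDerivAt_implicitFunctionOfProdDomain hinv).exists_lipschitzOnWith
  refine ⟨hd.implicitFunctionOfProdDomain hinv, C, _,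
    Filter.inter_mem hs (hd.eventually_apply_implicitFunctionOfProdDomain hinv),
    hC.mono inter_subset_left, ?_, ?_, ?_⟩
  · exact (hd.eventually_apply_eq_iff_implicitFunctionOfProdDomain hinv).self_of_nhds.mp rfl
  · intro y hy
    exact (hy.2 : f (y, _) = f (y₀, t₀)).trans h₀
  · filter_upwards [hd.eventually_apply_eq_iff_implicitFunctionOfProdDomain hinv] with v hv h
    exact hv.mp (h.trans h₀.symm)

theorem dimH_le_of_forall_nhdsWithin {X : Type*} [EMetricSpace X] [SecondCountableTopology X]
    {s : Set X} {d : ℝ≥0∞} (h : ∀ x ∈ s, ∃ t ∈ 𝓝[s] x, dimH t ≤ d) : dimH s ≤ d := by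
  by_contra! hd
  obtain ⟨x, hx, hx'⟩ := exists_mem_nhdsWithin_lt_dimH_of_lt_dimH hd
  obtain ⟨t, ht, htd⟩ := h x hx
  exact (hx' t ht).not_ge htd

/-- The real points of an ideal of `K[X]`. -/
def realZeros {K σ : Type*} [Field K] [Algebra K ℝ] (I : Ideal (MvPolynomial σ K)) :
    Set (σ → ℝ) :=
  {z | ∀ f ∈ I, MvPolynomial.aeval z f = 0}

theorem exists_simple_root_iterate_derivative {K ι : Type*} [Field K] [Algebra K ℝ]
    {q : Polynomial (MvPolynomial ι K)} (hq : q.Monic) {y : ι → ℝ} {t : ℝ}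
    (h : biEval q y t = 0) :
    ∃ k, biEval (Polynomial.derivative^[k] q) y t = 0 ∧
      biEval (Polynomial.derivative^[k] q).derivative y t ≠ 0 := by
  classical
  have key : ∃ k, biEval (Polynomial.derivative^[k] q) y t ≠ 0 := by
    by_contra! hk
    have h0 := (hq.map (MvPolynomial.aeval y : MvPolynomial ι K →ₐ[K] ℝ).toRingHom).ne_zero
    refine lt_irrefl _ ((Polynomial.lt_rootMultiplicity_iff_isRoot_iterate_derivative
      (t := t) (n := Polynomial.rootMultiplicity t _) h0).2 fun m _ => ?_)
    rw [Polynomial.iterate_derivative_map, Polynomial.IsRoot, Polynomial.eval_map]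
    exact hk m
  have hpos : Nat.find key ≠ 0 := fun h' => Nat.find_spec key (by rw [h']; exact h)
  obtain ⟨k, hk⟩ := Nat.exists_eq_succ_of_ne_zero hpos
  refine ⟨k, ?_, ?_⟩
  · by_contra hne
    exact Nat.find_min key (by omega) hne
  · have := Nat.find_spec key
    rwa [hk, Function.iterate_succ_apply'] at this

theorem dimH_realZeros_le {K σ ι : Type*} [Field K] [Algebra K ℝ] [Fintype σ] [Fintype ι]
    {I : Ideal (MvPolynomial σ K)} (g : MvPolynomial ι K →ₐ[K] MvPolynomial σ K ⧸ I)
    (hg : g.IsIntegral) : dimH (realZeros I) ≤ Fintype.card ι := by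
  choose f hf using fun i => Ideal.Quotient.mk_surjective (I := I) (g (.X i))
  have hgf : ∀ p, g p = Ideal.Quotient.mk I (MvPolynomial.aeval f p) := by
    intro p
    have : g = (Ideal.Quotient.mkₐ K I).comp (MvPolynomial.aeval f) := by
      ext i; simp [hf]
    rw [this]; rfl
  choose q hqm hq using fun j => hg (Ideal.Quotient.mk I (.X j))
  set F : (σ → ℝ) → ι → ℝ := fun z i => MvPolynomial.aeval z (f i)
  have hF : Continuous F := continuous_pi fun i => (contDiff_aeval (f i)).continuous
  have hroot : ∀ z ∈ realZeros I, ∀ j, biEval (q j) (F z) (z j) = 0 := by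
    intro z hz j
    have h1 :
        (q j).eval₂ (MvPolynomial.aeval f : MvPolynomial ι K →ₐ[K] _).toRingHom (.X j) ∈ I := by
      rw [← Ideal.Quotient.eq_zero_iff_mem, Polynomial.hom_eval₂, ← hq j]
      congr 1
      exact RingHom.ext fun p => (hgf p).symm
    have h2 := hz _ h1
    rw [← AlgHom.coe_toRingHom, Polynomial.hom_eval₂] at h2
    rw [← h2, biEval]
    congr 1
    · refine RingHom.ext fun p => ?_
      have : (MvPolynomial.aeval (F z) : MvPolynomial ι K →ₐ[K] ℝ)
          = (MvPolynomial.aeval z).comp (MvPolynomial.aeval f) := by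
        ext i; simp [F]
      exact DFunLike.congr_fun this p
    · simp
  have hcover : realZeros I ⊆ ⋃ k : σ → ℕ, {z | ∀ j,
      biEval (Polynomial.derivative^[k j] (q j)) (F z) (z j) = 0 ∧
      biEval (Polynomial.derivative^[k j] (q j)).derivative (F z) (z j) ≠ 0} := by
    intro z hz
    choose k hk using fun j => exists_simple_root_iterate_derivative (hqm j) (hroot z hz j)
    exact mem_iUnion.2 ⟨k, hk⟩
  refine (dimH_mono hcover).trans ?_
  rw [dimH_iUnion]
  refine iSup_le fun k => dimH_le_of_forall_nhdsWithin fun p hp => ?_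
  choose τ C s hs hLip _ _ hτ using fun j => exists_lipschitz_root _ (hp j).1 (hp j).2
  have hev : ∀ᶠ z in 𝓝 p, ∀ j, F z ∈ s j ∧
      (biEval (Polynomial.derivative^[k j] (q j)) (F z) (z j) = 0 → τ j (F z) = z j) := by
    refine Filter.eventually_all.2 fun j => (hF.continuousAt.eventually (hs j)).and ?_
    have hc : ContinuousAt (fun z : σ → ℝ => (F z, z j)) p :=
      (hF.prodMk (continuous_apply j)).continuousAt
    exact hc.eventually (hτ j)
  refine ⟨_, inter_mem_nhdsWithin _ hev, ?_⟩
  have hL : LipschitzOnWith (∑ j, C j) (fun y j => τ j y) (⋂ j, s j) := by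
    intro x hx y hy
    refine edist_pi_le_iff.2 fun j => (hLip j (mem_iInter.1 hx j) (mem_iInter.1 hy j)).trans ?_
    gcongr
    exact Finset.single_le_sum (fun _ _ => zero_le) (Finset.mem_univ j)
  calc dimH _ ≤ dimH ((fun y j => τ j y) '' ⋂ j, s j) := dimH_mono fun z hz =>
        ⟨F z, mem_iInter.2 fun j => (hz.2 j).1, funext fun j => (hz.2 j).2 (hz.1 j).1⟩
    _ ≤ dimH (⋂ j, s j) := hL.dimH_image_le
    _ ≤ dimH (univ : Set (ι → ℝ)) := dimH_mono (subset_univ _)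
    _ = Fintype.card ι := Real.dimH_univ_pi ι

theorem exists_isIntegral_primitive {R A σ : Type*} [CommRing R] [IsDomain R] [CharZero R]
    [CommRing A] [IsDomain A] [Algebra R A] [FaithfulSMul R A] [Algebra.IsAlgebraic R A]
    [Finite σ] (x : σ → A) :
    ∃ θ : A, IsIntegral R θ ∧ ∃ c : R, c ≠ 0 ∧ ∃ α : σ → Polynomial R,
      ∀ i, Polynomial.aeval θ (α i) = algebraMap R A c * x i := by
  have : Fintype σ := Fintype.ofFinite σ
  let k := FractionRing R
  let F := FractionRing A
  have hRF : Function.Injective (algebraMap R F) := FaithfulSMul.algebraMap_injective R F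
  let _ : Algebra k F := FractionRing.liftAlgebra R F
  have : IsScalarTower R k F := FractionRing.isScalarTower_liftAlgebra R F
  have : CharZero k := charZero_of_injective_algebraMap (IsFractionRing.injective R k)
  have hRF' : Algebra.IsAlgebraic R F := (IsFractionRing.isAlgebraic_iff' R A F).1 inferInstance
  have hkF : Algebra.IsAlgebraic k F :=
    Algebra.IsAlgebraic.extendScalars (IsFractionRing.injective R k)
  have : FiniteDimensional k (IntermediateField.adjoin k (range (algebraMap A F ∘ x))) :=
    IntermediateField.finiteDimensional_adjoin fun y _ => (hkF.isAlgebraic y).isIntegral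
  obtain ⟨γ, hγ⟩ := Field.exists_primitive_element k
    (IntermediateField.adjoin k (range (algebraMap A F ∘ x)))
  have hp : ∀ i, ∃ p : Polynomial k, Polynomial.aeval (γ : F) p = algebraMap A F (x i) := by
    intro i
    have hi : (⟨_, IntermediateField.subset_adjoin k _ (mem_range_self i)⟩ :
        IntermediateField.adjoin k (range (algebraMap A F ∘ x))) ∈
        (IntermediateField.adjoin k {γ}).toSubalgebra := by rw [hγ]; trivial
    rw [IntermediateField.adjoin_simple_toSubalgebra_of_isAlgebraic
      (Algebra.IsAlgebraic.isAlgebraic γ), Algebra.adjoin_singleton_eq_range_aeval] at hi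
    obtain ⟨p, hp⟩ := hi
    refine ⟨p, ?_⟩
    have := congrArg Subtype.val hp
    simpa using this
  choose p hp using hp
  obtain ⟨a, ⟨_, r, hr, rfl⟩, hγa⟩ := IsLocalization.exists_mk'_eq
    (Algebra.algebraMapSubmonoid A (nonZeroDivisors R)) (γ : F)
  have hr0 : r ≠ 0 := nonZeroDivisors.ne_zero hr
  obtain ⟨s, hs0, hs⟩ := (Algebra.IsAlgebraic.isAlgebraic (R := R) a).exists_integral_multiple
  set θ := s • a
  have hθ : (γ : F) = Polynomial.aeval (algebraMap A F θ)
      (Polynomial.C (algebraMap R k (s * r))⁻¹ * Polynomial.X) := by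
    have h1 := IsLocalization.mk'_spec F a
      (⟨_, r, hr, rfl⟩ : Algebra.algebraMapSubmonoid A (nonZeroDivisors R))
    rw [hγa] at h1
    have hr' : algebraMap R F r ≠ 0 := by rwa [Ne, map_eq_zero_iff _ hRF]
    have hs' : algebraMap R F s ≠ 0 := by rwa [Ne, map_eq_zero_iff _ hRF]
    simp only [← IsScalarTower.algebraMap_apply R A F] at h1
    simp only [θ, Algebra.smul_def, map_mul, Polynomial.aeval_C, Polynomial.aeval_X, map_inv₀,
      ← IsScalarTower.algebraMap_apply, ← h1]
    rw [eq_inv_mul_iff_mul_eq₀ (mul_ne_zero hs' hr')]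
    ring
  choose b hb hbp using fun i => IsLocalization.integerNormalization_spec (nonZeroDivisors R)
    ((p i).comp (Polynomial.C (algebraMap R k (s * r))⁻¹ * Polynomial.X))
  classical
  refine ⟨θ, hs, ∏ i, b i, Finset.prod_ne_zero_iff.2 fun i _ => nonZeroDivisors.ne_zero (hb i),
    fun i => Polynomial.C (∏ l ∈ Finset.univ.erase i, b l) *
      IsLocalization.integerNormalization (nonZeroDivisors R)
        ((p i).comp (Polynomial.C (algebraMap R k (s * r))⁻¹ * Polynomial.X)), fun i => ?_⟩
  apply IsFractionRing.injective A F
  rw [← Finset.mul_prod_erase _ _ (Finset.mem_univ i), ← Polynomial.aeval_algebraMap_apply,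
    map_mul, Polynomial.aeval_C, ← Polynomial.aeval_map_algebraMap k, hbp, Algebra.smul_def,
    map_mul, Polynomial.algebraMap_apply, Polynomial.aeval_C, Polynomial.aeval_comp, ← hθ, hp]
  simp only [map_mul, ← IsScalarTower.algebraMap_apply]
  ring

theorem biEval_add {K ι : Type*} [Field K] [Algebra K ℝ] (p q : Polynomial (MvPolynomial ι K))
    (y : ι → ℝ) (t : ℝ) : biEval (p + q) y t = biEval p y t + biEval q y t :=
  Polynomial.eval₂_add _ _

theorem biEval_sub {K ι : Type*} [Field K] [Algebra K ℝ] (p q : Polynomial (MvPolynomial ι K))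
    (y : ι → ℝ) (t : ℝ) : biEval (p - q) y t = biEval p y t - biEval q y t :=
  Polynomial.eval₂_sub _

theorem biEval_mul {K ι : Type*} [Field K] [Algebra K ℝ] (p q : Polynomial (MvPolynomial ι K))
    (y : ι → ℝ) (t : ℝ) : biEval (p * q) y t = biEval p y t * biEval q y t :=
  Polynomial.eval₂_mul _ _

theorem biEval_C {K ι : Type*} [Field K] [Algebra K ℝ] (r : MvPolynomial ι K)
    (y : ι → ℝ) (t : ℝ) : biEval (.C r) y t = MvPolynomial.aeval y r :=
  Polynomial.eval₂_C _ _

theorem continuousOn_biEval {K ι : Type*} [Field K] [Algebra K ℝ] [Fintype ι]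
    (p : Polynomial (MvPolynomial ι K)) {τ : (ι → ℝ) → ℝ} {U : Set (ι → ℝ)}
    (hτ : ContinuousOn τ U) : ContinuousOn (fun y => biEval p y (τ y)) U :=
  Continuous.comp_continuousOn (g := fun v : (ι → ℝ) × ℝ => biEval p v.1 v.2)
    (f := fun y => (y, τ y)) (contDiff_biEval p).continuous (continuousOn_id.prodMk hτ)

theorem exists_biEval_eq_mul_aeval {K ι σ A : Type*} [Field K] [Algebra K ℝ] [CommRing A]
    [Algebra K A] [Algebra (MvPolynomial ι K) A] [IsScalarTower K (MvPolynomial ι K) A]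
    {x : σ → A} {θ : A} {c : MvPolynomial ι K} {α : σ → Polynomial (MvPolynomial ι K)}
    (hα : ∀ i, Polynomial.aeval θ (α i) = algebraMap _ A c * x i) (g : MvPolynomial σ K) :
    ∃ (m : ℕ) (β : Polynomial (MvPolynomial ι K)),
      Polynomial.aeval θ β = algebraMap _ A c ^ m * MvPolynomial.aeval x g ∧
      ∀ (y : ι → ℝ) (t : ℝ), MvPolynomial.aeval y c ≠ 0 →
        biEval β y t = MvPolynomial.aeval y c ^ m *
          MvPolynomial.aeval (fun i => biEval (α i) y t / MvPolynomial.aeval y c) g := by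
  induction g using MvPolynomial.induction_on with
  | C a =>
    refine ⟨0, .C (.C a), ?_, fun y t _ => by simp [biEval]⟩
    simpa using (IsScalarTower.algebraMap_apply K (MvPolynomial ι K) A a).symm
  | add g₁ g₂ h₁ h₂ =>
    obtain ⟨m₁, β₁, hβ₁, hy₁⟩ := h₁
    obtain ⟨m₂, β₂, hβ₂, hy₂⟩ := h₂
    refine ⟨m₁ + m₂, .C (c ^ m₂) * β₁ + .C (c ^ m₁) * β₂, ?_, fun y t hc => ?_⟩
    · simp only [map_add, map_mul, Polynomial.aeval_C, hβ₁, hβ₂, map_pow]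
      ring
    · rw [biEval_add, biEval_mul, biEval_mul, biEval_C, biEval_C, hy₁ y t hc, hy₂ y t hc, map_pow,
        map_pow, map_add]
      ring
  | mul_X g i h =>
    obtain ⟨m, β, hβ, hy⟩ := h
    refine ⟨m + 1, β * α i, ?_, fun y t hc => ?_⟩
    · simp only [map_mul, hβ, hα, MvPolynomial.aeval_X]
      ring
    · rw [biEval_mul, hy y t hc, map_mul, MvPolynomial.aeval_X, pow_succ, mul_mul_mul_comm,
        mul_div_cancel₀ _ hc]

/-- Generically, `realZeros I` is locally a graph over the coordinates forming a transcendence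
basis of the coordinate ring. -/
theorem exists_local_section {K σ ι : Type*} [Field K] [Algebra K ℝ] [Finite σ] [Fintype ι]
    {I : Ideal (MvPolynomial σ K)} [I.IsPrime] {j : ι → σ}
    (hj : IsTranscendenceBasis K fun k => Ideal.Quotient.mk I (.X (j k))) :
    ∃ h ∉ I, ∀ p ∈ realZeros I, MvPolynomial.aeval p h ≠ 0 →
      ∃ U ∈ 𝓝 (p ∘ j), ∃ φ : (ι → ℝ) → σ → ℝ, ContinuousOn φ U ∧ φ (p ∘ j) = p ∧
        ∀ y ∈ U, φ y ∈ realZeros I ∧ φ y ∘ j = y := by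
  set A := MvPolynomial σ K ⧸ I
  set x : σ → A := fun i => Ideal.Quotient.mk I (.X i) with hx
  have hxg : ∀ g, MvPolynomial.aeval x g = Ideal.Quotient.mk I g := by
    intro g
    have : MvPolynomial.aeval x = Ideal.Quotient.mkₐ K I := by
      ext i; exact MvPolynomial.aeval_X x i
    rw [this]; rfl
  let R₀ := MvPolynomial ι K
  let φ₀ : R₀ →ₐ[K] A := MvPolynomial.aeval (x ∘ j)
  let _ : Algebra R₀ A := φ₀.toAlgebra
  have : IsScalarTower K R₀ A := .of_algebraMap_eq fun a => (φ₀.commutes a).symm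
  have hinj : Function.Injective (algebraMap R₀ A) := hj.1
  have : FaithfulSMul R₀ A := (faithfulSMul_iff_algebraMap_injective _ _).2 hinj
  have : CharZero K := (algebraMap K ℝ).charZero
  have := hj.isAlgebraic
  have : Algebra.IsAlgebraic R₀ A := Algebra.IsAlgebraic.of_ringHom_of_comp_eq
    hj.1.aevalEquiv (RingHom.id A) hj.1.aevalEquiv.surjective Function.injective_id
    (RingHom.ext hj.1.algebraMap_aevalEquiv)
  obtain ⟨θ, hθ, c, hc, α, hα⟩ := exists_isIntegral_primitive (R := R₀) x
  set q := minpoly R₀ θ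
  have hq' : Polynomial.aeval θ q.derivative ≠ 0 := by
    intro h0
    have hdeg := minpoly.natDegree_pos hθ
    have hne : q.derivative ≠ 0 := fun h => hdeg.ne' (Polynomial.derivative_eq_zero.1 h)
    exact Polynomial.not_dvd_of_natDegree_lt hne (Polynomial.natDegree_derivative_lt hdeg.ne')
      (minpoly.isIntegrallyClosed_dvd hθ h0)
  have hker : ∀ β : Polynomial R₀, Polynomial.aeval θ β = 0 → ∀ (y : ι → ℝ) t,
      biEval q y t = 0 → biEval β y t = 0 := by
    intro β hβ y t h
    obtain ⟨β', rfl⟩ := minpoly.isIntegrallyClosed_dvd hθ hβ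
    rw [biEval_mul, h, zero_mul]
  obtain ⟨h, hh⟩ := Ideal.Quotient.mk_surjective (I := I)
    (algebraMap R₀ A c * Polynomial.aeval θ q.derivative)
  refine ⟨h, fun hI => ?_, fun p hp hph => ?_⟩
  · rw [← Ideal.Quotient.eq_zero_iff_mem, hh, mul_eq_zero, map_eq_zero_iff _ hinj] at hI
    exact hI.elim hc hq'
  let ev : A →ₐ[K] ℝ := Ideal.Quotient.liftₐ I (MvPolynomial.aeval p) hp
  have hev : ∀ g, ev (Ideal.Quotient.mk I g) = MvPolynomial.aeval p g := fun g => rfl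
  have hevR : ∀ r : R₀, ev (algebraMap R₀ A r) = MvPolynomial.aeval (p ∘ j) r := by
    have : ev.comp φ₀ = MvPolynomial.aeval (p ∘ j) := by
      ext k; simp [φ₀, hx, hev]
    exact DFunLike.congr_fun this
  have hevβ : ∀ β : Polynomial R₀, ev (Polynomial.aeval θ β) = biEval β (p ∘ j) (ev θ) := by
    intro β
    rw [Polynomial.aeval_def, ← AlgHom.coe_toRingHom, Polynomial.hom_eval₂, biEval]
    congr 1
    exact RingHom.ext hevR
  rw [← hev, hh, map_mul, hevR, hevβ, mul_ne_zero_iff] at hph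
  obtain ⟨τ, C, s, hs, hLip, hτ₀, hτ, -⟩ := exists_lipschitz_root q
    (by rw [← hevβ, minpoly.aeval, map_zero]) hph.2
  have hcc : Continuous fun y : ι → ℝ => MvPolynomial.aeval y c := (contDiff_aeval c).continuous
  refine ⟨s ∩ {y | MvPolynomial.aeval y c ≠ 0},
    Filter.inter_mem hs (hcc.continuousAt.eventually_ne hph.1),
    fun y i => biEval (α i) y (τ y) / MvPolynomial.aeval y c, ?_, ?_, fun y hy => ⟨?_, ?_⟩⟩
  · refine continuousOn_pi.2 fun i => ContinuousOn.div ?_ hcc.continuousOn fun y hy => hy.2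
    exact continuousOn_biEval (α i) (hLip.continuousOn.mono inter_subset_left)
  · funext i
    change biEval (α i) (p ∘ j) (τ (p ∘ j)) / _ = _
    rw [hτ₀, ← hevβ, hα, map_mul, hevR, hx, hev, MvPolynomial.aeval_X, mul_div_cancel_left₀ _ hph.1]
  · intro g hg
    obtain ⟨m, β, hβ, hβy⟩ := exists_biEval_eq_mul_aeval hα g
    rw [hxg, Ideal.Quotient.eq_zero_iff_mem.2 hg, mul_zero] at hβ
    have := hβy y (τ y) hy.2
    rw [hker β hβ y _ (hτ y hy.1)] at this
    exact (mul_eq_zero.1 this.symm).resolve_left (pow_ne_zero _ hy.2)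
  · funext k
    have h0 : Polynomial.aeval θ (α (j k) - .C (c * .X k)) = 0 := by
      rw [map_sub, hα, Polynomial.aeval_C, map_mul, sub_eq_zero]
      congr 1
      exact (MvPolynomial.aeval_X (x ∘ j) k).symm
    have := hker _ h0 y _ (hτ y hy.1)
    rw [biEval_sub, sub_eq_zero, biEval_C, map_mul, MvPolynomial.aeval_X] at this
    change biEval (α (j k)) y (τ y) / _ = _
    rw [this, mul_div_cancel_left₀ _ hy.2]

theorem exists_isTranscendenceBasis_restrict {K A σ : Type*} [Field K] [CommRing A] [IsDomain A]
    [Algebra K A] (x : σ → A) [Algebra.IsAlgebraic (Algebra.adjoin K (range x)) A] (T : Set σ) :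
    ∃ B : Set σ, IsTranscendenceBasis K (fun k : B => x k) ∧
      ∀ b ∈ T, IsAlgebraic (Algebra.adjoin K (range fun k : ↥(B ∩ T) => x k)) (x b) := by
  classical
  obtain ⟨E, hE⟩ := (AlgebraicIndependent.matroid K A).exists_isBasis (x '' T)
  obtain ⟨hEi, hET, hEalg⟩ := AlgebraicIndependent.matroid_isBasis_iff.1 hE
  obtain ⟨B, hEB, hBx, hB⟩ := exists_isTranscendenceBasis_between E (range x)
    (hET.trans (image_subset_range _ _)) hEi
  have hsec : ∀ b : B, ∃ k, x k = b ∧ ((b : A) ∈ E → k ∈ T) := by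
    intro b
    by_cases hb : (b : A) ∈ E
    · obtain ⟨k, hk, hkb⟩ := hET hb
      exact ⟨k, hkb, fun _ => hk⟩
    · obtain ⟨k, hk⟩ := hBx b.2
      exact ⟨k, hk, fun h => absurd h hb⟩
  choose f hf hfT using hsec
  have hfinj : Function.Injective f := fun b b' h => Subtype.ext (by rw [← hf, h, hf])
  refine ⟨range f, ?_, fun b hb => ?_⟩
  · rw [← isTranscendenceBasis_equiv (Equiv.ofInjective f hfinj)]
    convert hB using 1
    funext b
    exact hf b
  · have hsub : E ⊆ range fun k : ↥(range f ∩ T) => x k := fun e he =>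
      ⟨⟨f ⟨e, hEB he⟩, mem_range_self _, hfT ⟨e, hEB he⟩ he⟩, hf _⟩
    exact (hEalg _ (mem_image_of_mem x hb)).adjoin_of_forall_isAlgebraic fun y hy =>
      absurd (hsub hy.1) hy.2

theorem AlgebraicIndependent.exists_eval₂_eq_zero {K A κ : Type*} [Field K] [CommRing A]
    [Algebra K A] {y : κ → A} (hy : AlgebraicIndependent K y) {b : A}
    (hb : IsAlgebraic (Algebra.adjoin K (range y)) b) :
    ∃ Q : Polynomial (MvPolynomial κ K), Q ≠ 0 ∧
      Q.eval₂ (MvPolynomial.aeval y : MvPolynomial κ K →ₐ[K] A).toRingHom b = 0 := by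
  obtain ⟨Q, hQ, hQb⟩ := hb
  refine ⟨Q.map hy.aevalEquiv.symm.toAlgHom.toRingHom, ?_, ?_⟩
  · rwa [Ne, Polynomial.map_eq_zero_iff hy.aevalEquiv.symm.injective]
  · rw [Polynomial.eval₂_map, ← hQb, Polynomial.aeval_def]
    congr 1
    refine RingHom.ext fun r => ?_
    obtain ⟨r, rfl⟩ := hy.aevalEquiv.surjective r
    simp

theorem card_le_dimH_of_forall_nhds {σ D : Type*} [Fintype σ] [Fintype D] (e : D → σ)
    {S : Set (σ → ℝ)} {w₀ : D → ℝ} (h : ∀ᶠ w in 𝓝 w₀, ∃ z ∈ S, z ∘ e = w) :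
    (Fintype.card D : ℝ≥0∞) ≤ dimH S := by
  have hL : LipschitzWith 1 fun z : σ → ℝ => z ∘ e := LipschitzWith.of_edist_le fun z z' =>
    edist_pi_le_iff.2 fun d => edist_le_pi_edist z z' (e d)
  calc (Fintype.card D : ℝ≥0∞) = dimH {w | ∃ z ∈ S, z ∘ e = w} := by
        rw [Real.dimH_of_mem_nhds (Filter.eventually_iff.1 h), Module.finrank_fintype_fun_eq_card]
    _ ≤ dimH S := hL.dimH_image_le S

/-- A continuous function whose values at `w` are roots of a fixed nonzero polynomial is locally
constant. -/
theorem eventually_eq_of_eventually_biEval_eq_zero {K κ D : Type*} [Field K] [Algebra K ℝ]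
    [Fintype D] {Q : Polynomial (MvPolynomial κ K)} {y : κ → ℝ}
    (hQ : MvPolynomial.aeval y Q.leadingCoeff ≠ 0) {f : (D → ℝ) → ℝ} {U : Set (D → ℝ)}
    {w₀ : D → ℝ} (hU : U ∈ 𝓝 w₀) (hf : ContinuousOn f U) (hfQ : ∀ w ∈ U, biEval Q y (f w) = 0) :
    ∀ᶠ w in 𝓝 w₀, f w = f w₀ := by
  set q := Q.map (MvPolynomial.aeval y : MvPolynomial κ K →ₐ[K] ℝ).toRingHom
  have hq : q ≠ 0 := fun h => hQ <| by
    have := congrArg (Polynomial.coeff · Q.natDegree) h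
    simpa [q] using this
  obtain ⟨ε, hε, hεU⟩ := Metric.mem_nhds_iff.1 hU
  filter_upwards [Metric.ball_mem_nhds w₀ hε] with w hw
  refine Metric.isPreconnected_ball.constant_of_mapsTo (Polynomial.rootSet_finite q ℝ).isDiscrete
    (hf.mono hεU) (fun v hv => ?_) hw (Metric.mem_ball_self hε)
  rw [Polynomial.mem_rootSet]
  refine ⟨hq, ?_⟩
  rw [Polynomial.coe_aeval_eq_eval, Polynomial.eval_map]
  exact hfQ v (hεU hv)

theorem AlgebraicIndependent.rename_notMem {K σ κ : Type*} [Field K]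
    {I : Ideal (MvPolynomial σ K)} {e : κ → σ}
    (he : AlgebraicIndependent K fun k => Ideal.Quotient.mk I (.X (e k)))
    {l : MvPolynomial κ K} (hl : l ≠ 0) : MvPolynomial.rename e l ∉ I := by
  rw [← Ideal.Quotient.eq_zero_iff_mem]
  intro h
  have hcomp : MvPolynomial.aeval (fun k => Ideal.Quotient.mk I (.X (e k))) =
      (Ideal.Quotient.mkₐ K I).comp (MvPolynomial.rename e) := by
    ext k
    simp
  refine hl (he ?_)
  rw [map_zero, hcomp]
  exact h

theorem exists_isTranscendenceBasis_ncard_le {K σ : Type*} [Field K] [Algebra K ℝ] [Fintype σ]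
    {I : Ideal (MvPolynomial σ K)} [I.IsPrime] {a u : σ} (hau : a ≠ u)
    (hI : ∀ g, (∀ z ∈ realZeros I ∩ {z | z u = Real.exp (z a)}, MvPolynomial.aeval z g = 0) →
      g ∈ I) :
    ∃ B : Set σ, IsTranscendenceBasis K (fun k : B => Ideal.Quotient.mk I (.X (k : σ))) ∧
      (B.ncard : ℝ≥0∞) ≤ dimH (realZeros I ∩ {z | z u = Real.exp (z a)}) + 1 := by
  classical
  set S := realZeros I ∩ {z | z u = Real.exp (z a)} with hS
  have hne : ∀ g ∉ I, ∃ z ∈ S, MvPolynomial.aeval z g ≠ 0 := fun g hg => by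
    by_contra! h
    exact hg (hI g h)
  have hgen : Algebra.IsAlgebraic (Algebra.adjoin K
      (range fun i => Ideal.Quotient.mk I (.X i))) (MvPolynomial σ K ⧸ I) := by
    refine ⟨fun b => ?_⟩
    obtain ⟨g, rfl⟩ := Ideal.Quotient.mk_surjective b
    have hg : Ideal.Quotient.mk I g ∈ Algebra.adjoin K
        (range fun i => Ideal.Quotient.mk I (.X i)) := by
      have : Ideal.Quotient.mkₐ K I g ∈
          (Algebra.adjoin K (range MvPolynomial.X)).map (Ideal.Quotient.mkₐ K I) :=
        Subalgebra.mem_map.2 ⟨g, MvPolynomial.adjoin_range_X (R := K) (σ := σ) ▸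
          Algebra.mem_top, rfl⟩
      rwa [AlgHom.map_adjoin, ← range_comp] at this
    exact isAlgebraic_algebraMap (⟨_, hg⟩ : Algebra.adjoin K _)
  obtain ⟨B, hB, hBalg⟩ := exists_isTranscendenceBasis_restrict (K := K)
    (fun i => Ideal.Quotient.mk I (.X i)) {a, u}
  refine ⟨B, hB, ?_⟩
  obtain ⟨h, hh, hsec⟩ := exists_local_section hB
  by_cases hcase : a ∈ B ∧ u ∈ B
  · obtain ⟨p, hpS, hp⟩ := hne h hh
    obtain ⟨U, hU, φ, hφ, hφp, hφU⟩ := hsec p hpS.1 hp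
    set D : Set σ := B \ {u}
    have haD : a ∈ D := ⟨hcase.1, hau⟩
    let T : (D → ℝ) → B → ℝ := fun w k =>
      if hk : (k : σ) = u then Real.exp (w ⟨a, haD⟩) else w ⟨k, k.2, hk⟩
    have hT : Continuous T := continuous_pi fun k => by
      by_cases hk : (k : σ) = u <;> simp only [T, hk, dite_true, dite_false] <;> fun_prop
    have hTp : T (fun d => p d) = p ∘ Subtype.val := by
      funext k
      by_cases hk : (k : σ) = u
      · simpa [T, hk] using hpS.2.symm
      · simp [T, hk]
    have hD := card_le_dimH_of_forall_nhds (S := S) (w₀ := fun d : D => p d) Subtype.val (by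
      have : T ⁻¹' U ∈ 𝓝 fun d : D => p d :=
        hT.continuousAt.preimage_mem_nhds (hTp ▸ hU : U ∈ 𝓝 (T fun d => p d))
      filter_upwards [this] with w hw
      obtain ⟨h₁, h₂⟩ := hφU _ hw
      refine ⟨φ (T w), ⟨h₁, ?_⟩, ?_⟩
      · have ha : φ (T w) a = T w ⟨a, hcase.1⟩ := congrFun h₂ ⟨a, hcase.1⟩
        have hu : φ (T w) u = T w ⟨u, hcase.2⟩ := congrFun h₂ ⟨u, hcase.2⟩
        simp [ha, hu, T, hau]
      · funext d
        have hd : φ (T w) d = T w ⟨d, d.2.1⟩ := congrFun h₂ ⟨d, d.2.1⟩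
        have hdu : (d : σ) ≠ u := d.2.2
        simp [hd, T, hdu])
    have hc : B.ncard = Fintype.card D + 1 := by
      rw [← Nat.card_eq_fintype_card, ← Set.ncard_sdiff_singleton_add_one hcase.2]; rfl
    rw [hc]
    push_cast
    gcongr
  · have hE : AlgebraicIndependent K
          fun k : ↥(B ∩ {a, u}) => Ideal.Quotient.mk I (.X (k : σ)) :=
      hB.1.comp (fun k : ↥(B ∩ {a, u}) => ⟨k, k.2.1⟩) fun k k' hk =>
        Subtype.ext (congrArg (fun b : B => (b : σ)) hk)
    obtain ⟨Qa, hQa, hQa'⟩ := hE.exists_eval₂_eq_zero (hBalg a (by simp))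
    obtain ⟨Qu, hQu, hQu'⟩ := hE.exists_eval₂_eq_zero (hBalg u (by simp))
    have hla := hE.rename_notMem (Polynomial.leadingCoeff_ne_zero.2 hQa)
    have hlu := hE.rename_notMem (Polynomial.leadingCoeff_ne_zero.2 hQu)
    have hP : I.IsPrime := inferInstance
    obtain ⟨p, hpS, hp⟩ := hne (h * (MvPolynomial.rename Subtype.val Qa.leadingCoeff *
        MvPolynomial.rename Subtype.val Qu.leadingCoeff)) fun hmem =>
      (hP.mem_or_mem hmem).elim hh fun hmem => (hP.mem_or_mem hmem).elim hla hlu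
    rw [map_mul, map_mul, mul_ne_zero_iff, mul_ne_zero_iff, MvPolynomial.aeval_rename,
      MvPolynomial.aeval_rename] at hp
    obtain ⟨U, hU, φ, hφ, hφp, hφU⟩ := hsec p hpS.1 hp.1
    set D : Set σ := B \ {a, u}
    let T : (D → ℝ) → B → ℝ := fun w k =>
      if hk : (k : σ) ∈ ({a, u} : Set σ) then p k else w ⟨k, k.2, hk⟩
    have hT : Continuous T := continuous_pi fun k => by
      by_cases hk : (k : σ) ∈ ({a, u} : Set σ) <;>
        simp only [T, hk, dite_true, dite_false] <;> fun_prop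
    have hTp : T (fun d => p d) = p ∘ Subtype.val := by
      funext k
      by_cases hk : (k : σ) ∈ ({a, u} : Set σ) <;> simp only [T, hk, dite_true, dite_false] <;> rfl
    have hTU : T ⁻¹' U ∈ 𝓝 fun d : D => p d :=
      hT.continuousAt.preimage_mem_nhds (hTp ▸ hU : U ∈ 𝓝 (T fun d => p d))
    have hconst : ∀ (b : σ) (Q : Polynomial (MvPolynomial ↥(B ∩ {a, u}) K)),
        Q.eval₂ (MvPolynomial.aeval fun k : ↥(B ∩ {a, u}) => Ideal.Quotient.mk I (.X (k : σ)) :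
          _ →ₐ[K] _).toRingHom (Ideal.Quotient.mk I (.X b)) = 0 →
        MvPolynomial.aeval (p ∘ Subtype.val) Q.leadingCoeff ≠ 0 →
        ∀ᶠ w in 𝓝 fun d : D => p d, φ (T w) b = p b := by
      intro b Q hQb hQ
      have hfp : p b = φ (T fun d => p d) b := by rw [hTp, hφp]
      rw [hfp]
      refine eventually_eq_of_eventually_biEval_eq_zero (f := fun w => φ (T w) b) hQ hTU
        ((continuous_apply b).comp_continuousOn (hφ.comp hT.continuousOn (mapsTo_preimage _ _)))
        fun w hw => ?_
      obtain ⟨h₁, h₂⟩ := hφU _ hw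
      let ev : (MvPolynomial σ K ⧸ I) →ₐ[K] ℝ :=
        Ideal.Quotient.liftₐ I (MvPolynomial.aeval (φ (T w))) h₁
      have hev : ∀ i, ev (Ideal.Quotient.mk I (.X i)) = φ (T w) i := MvPolynomial.aeval_X _
      have h0 := congrArg ev hQb
      rw [map_zero, ← AlgHom.coe_toRingHom, Polynomial.hom_eval₂] at h0
      rw [← h0, biEval]
      congr 1
      · refine RingHom.ext fun r => ?_
        have : (MvPolynomial.aeval (p ∘ Subtype.val) : MvPolynomial ↥(B ∩ {a, u}) K →ₐ[K] ℝ) =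
            ev.comp (MvPolynomial.aeval fun k : ↥(B ∩ {a, u}) =>
              Ideal.Quotient.mk I (.X (k : σ))) := by
          ext k
          have hk : φ (T w) k = T w ⟨k, k.2.1⟩ := congrFun h₂ ⟨k, k.2.1⟩
          have hkT : (k : σ) ∈ ({a, u} : Set σ) := k.2.2
          have hpk : p k = φ (T w) k := by simp only [hk, T, hkT, dite_true]
          simpa [hev] using hpk
        exact DFunLike.congr_fun this r
      · exact (hev b).symm
    have hD := card_le_dimH_of_forall_nhds (S := S) (w₀ := fun d : D => p d) Subtype.val (by
      filter_upwards [hTU, hconst a Qa hQa' hp.2.1, hconst u Qu hQu' hp.2.2] with w hw ha hu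
      obtain ⟨h₁, h₂⟩ := hφU _ hw
      refine ⟨φ (T w), ⟨h₁, ?_⟩, ?_⟩
      · rw [mem_ofPred_eq, ha, hu]; exact hpS.2
      · funext d
        have hd : φ (T w) d = T w ⟨d, d.2.1⟩ := congrFun h₂ ⟨d, d.2.1⟩
        have hdu : (d : σ) ∉ ({a, u} : Set σ) := d.2.2
        simp only [Function.comp, hd, T, hdu, dite_false])
    have hc : B.ncard ≤ Fintype.card D + 1 := by
      rw [← Nat.card_eq_fintype_card, Nat.card_coe_set_eq,
        ← Set.ncard_inter_add_ncard_sdiff_eq_ncard B {a, u}, add_comm]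
      gcongr
      rw [Set.ncard_le_one_iff]
      rintro b c ⟨hb, rfl | rfl⟩ ⟨hc, rfl | rfl⟩ <;> tauto
    refine (Nat.cast_le.2 hc).trans ?_
    push_cast
    gcongr

theorem dimH_realZeros_le_dimH_add_one {K σ : Type*} [Field K] [Algebra K ℝ] [Fintype σ]
    {I : Ideal (MvPolynomial σ K)} [I.IsPrime] {a u : σ} (hau : a ≠ u)
    (hI : ∀ g, (∀ z ∈ realZeros I ∩ {z | z u = Real.exp (z a)}, MvPolynomial.aeval z g = 0) →
      g ∈ I) :
    dimH (realZeros I) ≤ dimH (realZeros I ∩ {z | z u = Real.exp (z a)}) + 1 := by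
  obtain ⟨B, hB, hBdim⟩ := exists_isTranscendenceBasis_ncard_le hau hI
  obtain ⟨s, g, hg, hgi⟩ := exists_integral_inj_algHom_of_fg K (MvPolynomial σ K ⧸ I)
  have haeval : g = MvPolynomial.aeval fun i => g (.X i) := by ext; simp
  have hind : AlgebraicIndependent K fun i => g (.X i) := by
    rwa [AlgebraicIndependent, ← haeval]
  have hbasis : IsTranscendenceBasis K fun i => g (.X i) := by
    rw [hind.isTranscendenceBasis_iff_isAlgebraic]
    refine ⟨fun b => ?_⟩
    obtain ⟨q, hqm, hq⟩ := hgi b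
    refine ⟨q.map hind.aevalEquiv.toAlgHom.toRingHom, (hqm.map _).ne_zero, ?_⟩
    rw [Polynomial.aeval_def, Polynomial.eval₂_map, ← hq]
    congr 1
    refine RingHom.ext fun p => ?_
    exact (hind.algebraMap_aevalEquiv p).trans (DFunLike.congr_fun haeval p).symm
  have hcard := hbasis.lift_cardinalMk_eq hB
  have hs : s = B.ncard := by
    have := congrArg Cardinal.toNat hcard
    rw [← Nat.card_coe_set_eq]
    simpa [Cardinal.mk_fin, Nat.card] using this
  calc dimH (realZeros I) ≤ Fintype.card (Fin s) := dimH_realZeros_le g hgi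
    _ = B.ncard := by rw [Fintype.card_fin, hs]
    _ ≤ _ := hBdim

theorem realZeros_inf {K σ : Type*} [Field K] [Algebra K ℝ] (I J : Ideal (MvPolynomial σ K)) :
    realZeros (I ⊓ J) = realZeros I ∪ realZeros J := by
  ext z
  constructor
  · intro hz
    by_contra! h
    simp only [mem_union, not_or, realZeros, mem_ofPred_eq, not_forall] at h
    obtain ⟨⟨f, hf, hf0⟩, g, hg, hg0⟩ := h
    have := hz (f * g) ⟨I.mul_mem_right g hf, J.mul_mem_left f hg⟩
    rw [map_mul] at this
    exact (mul_ne_zero hf0 hg0) this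
  · rintro (hz | hz) f hf
    exacts [hz f hf.1, hz f hf.2]

theorem realZeros_sup_span_singleton {K σ : Type*} [Field K] [Algebra K ℝ]
    (J : Ideal (MvPolynomial σ K)) (g : MvPolynomial σ K) :
    realZeros (J ⊔ Ideal.span {g}) = realZeros J ∩ {z | MvPolynomial.aeval z g = 0} := by
  ext z
  constructor
  · exact fun hz => ⟨fun f hf => hz f (Ideal.mem_sup_left hf),
      hz g (Ideal.mem_sup_right (Ideal.mem_span_singleton_self g))⟩
  · rintro ⟨hz, hg⟩
    have : J ⊔ Ideal.span {g} ≤ RingHom.ker (MvPolynomial.aeval z : MvPolynomial σ K →ₐ[K] ℝ) :=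
      sup_le hz ((Ideal.span_singleton_le_iff_mem _).2 hg)
    exact this

theorem exists_realZeros_inter_eq {K σ : Type*} [Field K] [Algebra K ℝ] [Fintype σ]
    {a u : σ} (hau : a ≠ u) (J : Ideal (MvPolynomial σ K)) :
    ∃ W : Ideal (MvPolynomial σ K),
      realZeros W ∩ {z | z u = Real.exp (z a)} = realZeros J ∩ {z | z u = Real.exp (z a)} ∧
      dimH (realZeros W) ≤ dimH (realZeros J ∩ {z | z u = Real.exp (z a)}) + 1 := by
  set Γ : Set (σ → ℝ) := {z | z u = Real.exp (z a)} with hΓ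
  let van : Set (σ → ℝ) → Ideal (MvPolynomial σ K) := fun S =>
    ⨅ z ∈ S, RingHom.ker (MvPolynomial.aeval z : MvPolynomial σ K →ₐ[K] ℝ)
  have mem_van : ∀ S f, f ∈ van S ↔ ∀ z ∈ S, MvPolynomial.aeval z f = 0 := by
    simp [van, RingHom.mem_ker]
  induction hI : van (realZeros J ∩ Γ) using WellFoundedGT.induction generalizing J with
  | ind I ih =>
  have hmem {f} : f ∈ I ↔ ∀ z ∈ realZeros J ∩ Γ, MvPolynomial.aeval z f = 0 := by
    rw [← hI, mem_van]
  by_cases hP : I.IsPrime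
  · have hS : realZeros I ∩ Γ = realZeros J ∩ Γ := by
      exact Subset.antisymm
        (fun z hz => ⟨fun f hf => hz.1 f (hmem.2 fun y hy => hy.1 f hf), hz.2⟩)
        fun z hz => ⟨fun f hf => hmem.1 hf z hz, hz.2⟩
    refine ⟨I, hS, ?_⟩
    rw [← hS]
    refine dimH_realZeros_le_dimH_add_one hau fun g hg => ?_
    rw [← hΓ, hS] at hg
    exact hmem.2 hg
  rcases Ideal.not_isPrime_iff.1 hP with htop | ⟨g, hg, h, hh, hgh⟩
  · have hS : realZeros J ∩ Γ = ∅ := by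
      refine eq_empty_of_forall_notMem fun z hz => ?_
      simpa using hmem.1 (htop ▸ Submodule.mem_top : (1 : MvPolynomial σ K) ∈ I) z hz
    have hW : realZeros (⊤ : Ideal (MvPolynomial σ K)) = ∅ :=
      eq_empty_of_forall_notMem fun z hz => by simpa using hz 1 trivial
    exact ⟨⊤, by simp [hS, hW], by simp [hW]⟩
  · have hlt : ∀ f ∉ I, I < van (realZeros (J ⊔ Ideal.span {f}) ∩ Γ) := by
      intro f hf
      rw [realZeros_sup_span_singleton]
      refine lt_of_le_of_ne (fun q hq => (mem_van _ _).2 fun z hz => ?_) fun heq => hf ?_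
      · exact hmem.1 hq z ⟨hz.1.1, hz.2⟩
      · rw [heq]
        exact (mem_van _ _).2 fun z hz => hz.1.2
    obtain ⟨W₁, hW₁, hd₁⟩ := ih _ (hlt g hg) _ rfl
    obtain ⟨W₂, hW₂, hd₂⟩ := ih _ (hlt h hh) _ rfl
    have hS : realZeros J ∩ Γ =
        realZeros (J ⊔ Ideal.span {g}) ∩ Γ ∪ realZeros (J ⊔ Ideal.span {h}) ∩ Γ := by
      rw [realZeros_sup_span_singleton, realZeros_sup_span_singleton]
      ext z
      constructor
      · intro hz
        have h0 := hmem.1 hgh z hz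
        rw [map_mul, mul_eq_zero] at h0
        exact h0.imp (fun h0 => ⟨⟨hz.1, h0⟩, hz.2⟩) fun h0 => ⟨⟨hz.1, h0⟩, hz.2⟩
      · rintro (hz | hz) <;> exact ⟨hz.1.1, hz.2⟩
    refine ⟨W₁ ⊓ W₂, ?_, ?_⟩
    · rw [realZeros_inf, union_inter_distrib_right, hW₁, hW₂, hS]
    · rw [realZeros_inf, dimH_union, hS]
      refine max_le (hd₁.trans ?_) (hd₂.trans ?_) <;> gcongr
      exacts [subset_union_left, subset_union_right]

theorem isAlgSet_realZeros {σ : Type*} [Finite σ] {K : Subfield ℝ}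
    (I : Ideal (MvPolynomial σ K)) : IsAlgSet K (realZeros I) := by
  obtain ⟨S, rfl⟩ := I.fg_of_isNoetherianRing
  refine ⟨(∑ f ∈ S, f ^ 2).map K.subtype, fun m => ?_, ?_⟩
  · rw [MvPolynomial.coeff_map]
    exact SetLike.coe_mem _
  · ext z
    have heval : MvPolynomial.eval z ((∑ f ∈ S, f ^ 2).map K.subtype) =
        ∑ f ∈ S, MvPolynomial.aeval z f ^ 2 := by
      rw [MvPolynomial.eval_map]
      exact (map_sum (MvPolynomial.aeval z) _ _).trans (by simp only [map_pow])
    rw [mem_ofPred_eq, heval, Finset.sum_eq_zero_iff_of_nonneg fun _ _ => sq_nonneg _]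
    simp only [pow_eq_zero_iff two_ne_zero]
    refine ⟨fun hz f hf => hz f (Ideal.subset_span hf), fun hz => ?_⟩
    have : Ideal.span (S : Set (MvPolynomial σ K)) ≤
        RingHom.ker (MvPolynomial.aeval z : MvPolynomial σ K →ₐ[K] ℝ) := Ideal.span_le.2 hz
    exact this

theorem CoeffsIn.exists_map_eq {σ : Type*} {K : Subfield ℝ} {P : MvPolynomial σ ℝ}
    (hP : CoeffsIn K P) : ∃ p : MvPolynomial σ K, p.map K.subtype = P := by
  refine MvPolynomial.mem_range_map_iff_coeffs_subset.2 fun c hc => ?_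
  obtain ⟨m, -, rfl⟩ := MvPolynomial.mem_coeffs_iff.1 hc
  exact ⟨⟨_, hP m⟩, rfl⟩

theorem dimH_graph_le {n : ℕ} (hn : 0 < n) (V : Set (Fin n → ℝ)) :
    dimH ((fun x : Fin n → ℝ =>
      (Sum.elim x fun _ => Real.exp (x ⟨0, hn⟩) : Fin n ⊕ Unit → ℝ)) '' V) ≤ dimH V := by
  refine ContDiffOn.dimH_image_le (ContDiff.contDiffOn (s := univ) ?_) convex_univ
    (subset_univ V)
  rw [contDiff_pi]
  rintro (i | _)
  · exact contDiff_apply ℝ ℝ i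
  · exact Real.contDiff_exp.comp (contDiff_apply ℝ ℝ _)

end

/-- For every `P ∈ 𝕂[X₁,…,Xₙ,U₁]` there exists an admissible real algebraic set over `𝕂`
for the exponential set `V = {x : P(x, e^{x₁}) = 0}`. -/
theorem stmt6 (n : ℕ) (hn : 0 < n) (K : Subfield ℝ) (hK : RealAlgExt K)
    (P : MvPolynomial (Fin n ⊕ Unit) ℝ) (hP : CoeffsIn K P) :
    ∃ W : Set ((Fin n ⊕ Unit) → ℝ),
      Admissible hn K P {x | expEval1 hn P x = 0} W := by
  obtain ⟨p, rfl⟩ := hP.exists_map_eq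
  obtain ⟨W, hW, hdim⟩ := exists_realZeros_inter_eq
    (a := (Sum.inl ⟨0, hn⟩ : Fin n ⊕ Unit)) (u := Sum.inr ()) Sum.inl_ne_inr (Ideal.span {p})
  have hmem (z : Fin n ⊕ Unit → ℝ) :
      z ∈ realZeros (Ideal.span {p}) ↔ MvPolynomial.eval z (p.map K.subtype) = 0 := by
    rw [MvPolynomial.eval_map]
    refine ⟨fun hz => hz p (Ideal.mem_span_singleton_self p), fun hz f hf => ?_⟩
    obtain ⟨q, rfl⟩ := Ideal.mem_span_singleton.1 hf
    rw [map_mul, show MvPolynomial.aeval z p = 0 from hz, zero_mul]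
  have hgraph (z) (hz : z ∈ Gamma1 hn) :
      (Sum.elim (proj1 z) fun _ => Real.exp (proj1 z ⟨0, hn⟩)) = z := by
    ext (i | i)
    exacts [rfl, hz.symm]
  refine ⟨realZeros W, isAlgSet_realZeros W, ?_, hdim.trans ?_⟩
  · rw [show realZeros W ∩ Gamma1 hn = realZeros (Ideal.span {p}) ∩ Gamma1 hn from hW]
    refine Subset.antisymm (fun x hx => ?_) ?_
    · exact ⟨Sum.elim x fun _ => Real.exp (x ⟨0, hn⟩), Or.inl ⟨(hmem _).2 hx, rfl⟩, rfl⟩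
    · rintro _ ⟨z, hz | ⟨hz, h0, h1⟩, rfl⟩
      · rw [mem_ofPred_eq, expEval1, hgraph z hz.2]
        exact (hmem z).1 hz.1
      · have hΓ : z ∈ Gamma1 hn := by rw [Gamma1, mem_ofPred_eq, h0, h1, Real.exp_zero]
        rw [mem_ofPred_eq, expEval1, hgraph z hΓ]
        exact hz
  · gcongr
    refine (dimH_mono fun z hz => ?_).trans (dimH_graph_le hn _)
    refine ⟨proj1 z, ?_, hgraph z hz.2⟩
    rw [mem_ofPred_eq, expEval1, hgraph z hz.2]
    exact (hmem z).1 hz.1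

end
end

section
/- Let P ∈ 𝕂[X₁,…,Xₙ,U₁,…,Uₙ] and let x = (x₁,…,xₙ) ∈ ℝⁿ be a point all of whose coordinates are algebraic over ℚ. If the polynomial Q(U₁,…,Uₙ) := P(x₁,…,xₙ,U₁,…,Uₙ) is not identically zero and Q(e^{x₁},…,e^{xₙ}) = 0, then x ∈ W_P; that is, there exist two distinct U-monomials of P, with exponent vectors (d_{1ν},…,d_{nν}) ≠ (d_{1μ},…,d_{nμ}), such that d_{1ν}x₁+⋯+d_{nν}xₙ = d_{1μ}x₁+⋯+d_{nμ}xₙ. -/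
open MeasureTheory Set
open scoped ENNReal

noncomputable section

/-- The polynomial `Q(U) := P(x, U)` obtained from `P` by substituting `x` for `X`. -/
def substX {n : ℕ} (P : MvPolynomial (Fin n ⊕ Fin n) ℝ) (x : Fin n → ℝ) :
    MvPolynomial (Fin n) ℝ :=
  MvPolynomial.aeval (Sum.elim (fun i => MvPolynomial.C (x i)) MvPolynomial.X) P

section GaloisGroupAlgebra

open scoped AddMonoidAlgebra

variable {L : Type*} [Field L]

/-- The diagonal action of `Gal(L/ℚ)` on the group algebra `L[L]`, on both the coefficients
and the exponents. -/
def galGroupAlgebra [Algebra ℚ L] (σ : Gal(L/ℚ)) : L[L] ≃+* L[L] :=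
  (AddMonoidAlgebra.mapRingEquiv L σ.toRingEquiv).trans
    (AddMonoidAlgebra.mapDomainRingEquiv L σ.toRingEquiv.toAddEquiv)

lemma coeff_galGroupAlgebra [Algebra ℚ L] (σ : Gal(L/ℚ)) (x : L[L]) (a : L) :
    (galGroupAlgebra σ x).coeff (σ a) = σ (x.coeff a) := by
  simp [galGroupAlgebra, Finsupp.equivMapDomain_apply]

lemma galGroupAlgebra_mul [Algebra ℚ L] (σ τ : Gal(L/ℚ)) (x : L[L]) :
    galGroupAlgebra (σ * τ) x = galGroupAlgebra σ (galGroupAlgebra τ x) := by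
  ext a
  obtain ⟨b, rfl⟩ := (σ * τ).surjective a
  rw [coeff_galGroupAlgebra, AlgEquiv.mul_apply, AlgEquiv.mul_apply, coeff_galGroupAlgebra,
    coeff_galGroupAlgebra]

lemma galGroupAlgebra_one [Algebra ℚ L] (x : L[L]) : galGroupAlgebra (1 : Gal(L/ℚ)) x = x := by
  ext a
  simpa using coeff_galGroupAlgebra (1 : Gal(L/ℚ)) x a

/-- The ring homomorphism `L[L] → ℂ` sending the basis element of `a` to `exp a`. -/
def expGroupAlgebra (L : Type*) [Field L] [Algebra L ℂ] : L[L] →ₐ[L] ℂ :=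
  AddMonoidAlgebra.lift L ℂ L
    { toFun := fun a => Complex.exp (algebraMap L ℂ a.toAdd)
      map_one' := by simp
      map_mul' := fun a b => by simp [Complex.exp_add] }

lemma expGroupAlgebra_apply [Algebra L ℂ] (x : L[L]) :
    expGroupAlgebra L x =
      ∑ a ∈ x.coeff.support, algebraMap L ℂ (x.coeff a) * Complex.exp (algebraMap L ℂ a) := by
  simp [expGroupAlgebra, AddMonoidAlgebra.lift_apply, Finsupp.sum, Algebra.smul_def]

lemma exists_galois_invariant_of_expGroupAlgebra_eq_zero [CharZero L] [Algebra ℚ L]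
    [FiniteDimensional ℚ L] [Algebra L ℂ] {x : L[L]} (hx : x ≠ 0) (h : expGroupAlgebra L x = 0) :
    ∃ y : L[L], expGroupAlgebra L y = 0 ∧ y.coeff 0 = Fintype.card Gal(L/ℚ) ∧
      ∀ (σ : Gal(L/ℚ)) (a : L), y.coeff (σ a) = σ (y.coeff a) := by
  classical
  set z : L[L] := ∏ σ : Gal(L/ℚ), galGroupAlgebra σ x with hz
  have hz0 : z ≠ 0 := Finset.prod_ne_zero_iff.2 fun σ _ => by simpa using hx
  have hzE : expGroupAlgebra L z = 0 := by
    rw [hz, map_prod]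
    exact Finset.prod_eq_zero (Finset.mem_univ 1) (by rw [galGroupAlgebra_one, h])
  have hzinv (σ : Gal(L/ℚ)) : galGroupAlgebra σ z = z := by
    rw [hz, map_prod]
    exact Fintype.prod_equiv (Equiv.mulLeft σ) _ _ fun τ => (galGroupAlgebra_mul σ τ x).symm
  obtain ⟨a, ha⟩ : ∃ a, z.coeff a ≠ 0 := by
    by_contra! hcon
    exact hz0 (by ext a; simpa using hcon a)
  set w : L[L] := ∑ σ : Gal(L/ℚ), galGroupAlgebra σ (.single (-a) (z.coeff a)⁻¹) with hw
  have hwinv (σ : Gal(L/ℚ)) : galGroupAlgebra σ w = w := by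
    rw [hw, map_sum]
    exact Fintype.sum_equiv (Equiv.mulLeft σ) _ _ fun τ => (galGroupAlgebra_mul σ τ _).symm
  refine ⟨w * z, by rw [map_mul, hzE, mul_zero], ?_, fun σ b => ?_⟩
  · have hc (σ : Gal(L/ℚ)) :
        (galGroupAlgebra σ (.single (-a) (z.coeff a)⁻¹) * z).coeff 0 = 1 := by
      have h1 : galGroupAlgebra σ (.single (-a) (z.coeff a)⁻¹) * z =
          galGroupAlgebra σ (.single (-a) (z.coeff a)⁻¹ * z) := by rw [map_mul, hzinv]
      rw [h1, ← map_zero σ, coeff_galGroupAlgebra, AddMonoidAlgebra.coeff_single_mul_apply]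
      simp [ha]
    rw [hw, Finset.sum_mul, AddMonoidAlgebra.coeff_sum, Finsupp.finsetSum_apply,
      Finset.sum_congr rfl fun σ _ => hc σ]
    simp
  · conv_lhs => rw [← hwinv σ, ← hzinv σ, ← map_mul]
    exact coeff_galGroupAlgebra _ _ _

end GaloisGroupAlgebra

open Polynomial in
lemma isIntegral_pow_mul_aeval {L : Type*} [Field L] {k : ℤ} {a : L}
    (ha : IsIntegral ℤ ((k : L) * a)) {g : ℤ[X]} {N : ℕ} (hg : g.natDegree ≤ N) :
    IsIntegral ℤ ((k : L) ^ N * aeval a g) := by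
  have hk : IsIntegral ℤ (k : L) := isIntegral_algebraMap (R := ℤ) (x := k)
  rw [aeval_eq_sum_range, Finset.mul_sum]
  refine IsIntegral.sum _ fun i hi => ?_
  have hi' : i ≤ N := (Nat.lt_succ_iff.1 (Finset.mem_range.1 hi)).trans hg
  have : (k : L) ^ N * g.coeff i • a ^ i = g.coeff i • ((k : L) ^ (N - i) * (k * a) ^ i) := by
    rw [mul_pow, ← mul_assoc ((k : L) ^ (N - i)), ← pow_add, Nat.sub_add_cancel hi', mul_smul_comm]
  rw [this]
  exact ((hk.pow _).mul (ha.pow _)).smul _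

open Polynomial in
lemma exists_int_polynomial_eval_zero_ne_zero {L : Type*} [Field L] [CharZero L]
    [Algebra ℚ L] [Algebra.IsAlgebraic ℚ L] (s : Finset L) (hs : 0 ∉ s) :
    ∃ f : ℤ[X], f.eval 0 ≠ 0 ∧ ∀ a ∈ s, aeval a f = 0 := by
  have key (a : L) (ha : a ≠ 0) : ∃ f : ℤ[X], f.eval 0 ≠ 0 ∧ aeval a f = 0 := by
    have h1 : IsAlgebraic ℤ a :=
      (IsFractionRing.isAlgebraic_iff ℤ ℚ L).2 (Algebra.IsAlgebraic.isAlgebraic a)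
    obtain ⟨q, hq, hq'⟩ :=
      h1.exists_nonzero_coeff_and_aeval_eq_zero (mem_nonZeroDivisors_of_ne_zero ha)
    exact ⟨q, by rwa [← coeff_zero_eq_eval_zero], hq'⟩
  choose! F hF0 hF using key
  refine ⟨∏ a ∈ s, F a, ?_, fun a ha => ?_⟩
  · rw [eval_prod]
    exact Finset.prod_ne_zero_iff.2 fun a ha => hF0 a fun h => hs (h ▸ ha)
  · rw [map_prod]
    exact Finset.prod_eq_zero ha (hF a fun h => hs (h ▸ ha))

lemma exists_int_of_isIntegral_of_fixed {L : Type*} [Field L] [CharZero L]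
    [Algebra ℚ L] [FiniteDimensional ℚ L] [IsGalois ℚ L] {t : L} (ht : IsIntegral ℤ t)
    (h : ∀ σ : Gal(L/ℚ), σ t = t) : ∃ m : ℤ, (m : L) = t := by
  obtain ⟨q, rfl⟩ := (IsGalois.mem_range_algebraMap_iff_fixed t).2 h
  rw [isIntegral_algebraMap_iff (algebraMap ℚ L).injective] at ht
  obtain ⟨m, rfl⟩ := IsIntegrallyClosed.isIntegral_iff.1 ht
  exact ⟨m, by simp⟩

lemma exists_prime_mul_pow_div_factorial_lt_one (A B : ℝ) (M : ℕ) :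
    ∃ p > M, p.Prime ∧ A * (B ^ p / (p - 1).factorial) < 1 := by
  have h : Filter.Tendsto (fun n : ℕ => A * B * (B ^ n / n.factorial)) Filter.atTop (nhds 0) := by
    simpa using (FloorSemiring.tendsto_pow_div_factorial_atTop B).const_mul (A * B)
  obtain ⟨N, hN⟩ := Filter.eventually_atTop.1 (h.eventually_lt_const one_pos)
  obtain ⟨p, hp, hpp⟩ := Nat.exists_infinite_primes (N + M + 2)
  refine ⟨p, by omega, hpp, ?_⟩
  have := hN (p - 1) (by omega)
  obtain ⟨q, rfl⟩ : ∃ q, p = q + 1 := ⟨p - 1, by omega⟩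
  simp only [Nat.add_sub_cancel] at this ⊢
  rw [pow_succ]
  calc _ = _ := by ring
    _ < 1 := this

open Polynomial in
open scoped AddMonoidAlgebra in
lemma expGroupAlgebra_ne_zero_of_galois_invariant {L : Type*} [Field L] [CharZero L]
    [Algebra ℚ L] [FiniteDimensional ℚ L] [IsGalois ℚ L] [Algebra L ℂ] {y : L[L]} {G : ℕ}
    (hG : G ≠ 0) (h0 : y.coeff 0 = G)
    (hinv : ∀ (σ : Gal(L/ℚ)) (a : L), y.coeff (σ a) = σ (y.coeff a)) :
    expGroupAlgebra L y ≠ 0 := by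
  classical
  intro hE
  set s := y.coeff.support.erase 0 with hs
  obtain ⟨f, hf0, hf⟩ := exists_int_polynomial_eval_zero_ne_zero s (by simp [hs])
  obtain ⟨k, hk0, hk⟩ :=
    exists_integral_multiples ℤ ℚ (y.coeff.support ∪ y.coeff.support.image y.coeff)
  simp only [zsmul_eq_mul] at hk
  obtain ⟨C, hC⟩ := LindemannWeierstrass.exp_polynomial_approx f hf0
  set D := f.natDegree
  obtain ⟨p, hpM, hp, hp1⟩ := exists_prime_mul_pow_div_factorial_lt_one
    (|(k : ℝ)| * ∑ a ∈ s, ‖algebraMap L ℂ (y.coeff a)‖) (|(k : ℝ)| ^ D * C)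
    ((eval 0 f).natAbs + k.natAbs + G)
  obtain ⟨n, hn, g, hg, hgf⟩ := hC p (by omega) hp
  set T : L := ∑ a ∈ s, y.coeff a * aeval a g with hT
  have hTfix (σ : Gal(L/ℚ)) : σ T = T := by
    rw [hT, map_sum]
    refine Finset.sum_bij' (fun a _ => σ a) (fun a _ => σ.symm a) ?_ ?_ ?_ ?_ ?_
    · intro a ha
      simpa [hs, hinv] using ha
    · intro a ha
      have := hinv σ (σ.symm a)
      rw [σ.apply_symm_apply] at this
      simpa [hs, this] using ha
    · simp
    · simp
    · intro a _
      rw [map_mul, hinv]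
      congr 1
      exact (aeval_algHom_apply (σ.toAlgHom.restrictScalars ℤ) a g).symm
  have hTint : IsIntegral ℤ ((k : L) ^ (p * D + 1) * T) := by
    rw [hT, Finset.mul_sum]
    refine IsIntegral.sum _ fun a ha => ?_
    have hay : a ∈ y.coeff.support := Finset.mem_of_mem_erase ha
    have h1 := isIntegral_pow_mul_aeval (hk a (Finset.mem_union_left _ hay))
      (hg.trans (Nat.sub_le _ _))
    have h2 := hk _ (Finset.mem_union_right _ (Finset.mem_image_of_mem y.coeff hay))
    convert h2.mul h1 using 1
    ring
  obtain ⟨m, hm⟩ := exists_int_of_isIntegral_of_fixed hTint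
    (fun σ => by rw [map_mul, map_pow, map_intCast, hTfix])
  have hexp : (G : ℂ) + ∑ a ∈ s, algebraMap L ℂ (y.coeff a) * Complex.exp (algebraMap L ℂ a)
      = 0 := by
    rw [expGroupAlgebra_apply, ← Finset.add_sum_erase _ _
      (show (0 : L) ∈ y.coeff.support by simp [h0, hG])] at hE
    simpa [h0] using hE
  set z : ℤ := k ^ (p * D + 1) * (n * G) + p * m with hz
  have hzC : (z : ℂ) = -((k : ℂ) ^ (p * D + 1) * ∑ a ∈ s, algebraMap L ℂ (y.coeff a) *
      (n • Complex.exp (algebraMap L ℂ a) - p • aeval (algebraMap L ℂ a) g)) := by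
    have hm' : (m : ℂ) = (k : ℂ) ^ (p * D + 1) *
        ∑ a ∈ s, algebraMap L ℂ (y.coeff a) * aeval (algebraMap L ℂ a) g := by
      rw [← map_intCast (algebraMap L ℂ) m, hm, hT]
      simp [aeval_algebraMap_apply]
    have hsum : ∑ a ∈ s, algebraMap L ℂ (y.coeff a) *
        (n • Complex.exp (algebraMap L ℂ a) - p • aeval (algebraMap L ℂ a) g) =
        n * ∑ a ∈ s, algebraMap L ℂ (y.coeff a) * Complex.exp (algebraMap L ℂ a) -
        p * ∑ a ∈ s, algebraMap L ℂ (y.coeff a) * aeval (algebraMap L ℂ a) g := by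
      rw [Finset.mul_sum, Finset.mul_sum, ← Finset.sum_sub_distrib]
      refine Finset.sum_congr rfl fun a _ => ?_
      simp only [zsmul_eq_mul, nsmul_eq_mul]
      ring
    rw [hsum, hz]
    push_cast
    rw [hm']
    linear_combination (k : ℂ) ^ (p * D + 1) * n * hexp
  have hznorm : ‖(z : ℂ)‖ < 1 := by
    refine lt_of_le_of_lt ?_ hp1
    rw [hzC, norm_neg, norm_mul, norm_pow, Complex.norm_intCast]
    calc _ ≤ |(k : ℝ)| ^ (p * D + 1) *
          ∑ a ∈ s, ‖algebraMap L ℂ (y.coeff a)‖ * (C ^ p / (p - 1).factorial) := by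
          gcongr
          refine (norm_sum_le _ _).trans (Finset.sum_le_sum fun a ha => ?_)
          rw [norm_mul]
          gcongr
          refine hgf ?_
          rw [mem_aroots]
          refine ⟨fun h => hf0 (by simp [h]), ?_⟩
          rw [aeval_algebraMap_apply, hf a ha, map_zero]
      _ = _ := by
          rw [← Finset.sum_mul]
          ring
  have hz0 : z = 0 := by
    rw [Complex.norm_intCast] at hznorm
    exact Int.abs_lt_one_iff.1 (by exact_mod_cast hznorm)
  have hdvd : (p : ℤ) ∣ k ^ (p * D + 1) * (n * G) :=
    (dvd_add_left (dvd_mul_right (p : ℤ) m)).1 (hz ▸ hz0 ▸ dvd_zero _)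
  have hpZ := Nat.prime_iff_prime_int.1 hp
  rcases hpZ.dvd_or_dvd hdvd with h | h
  · have := Nat.le_of_dvd (Int.natAbs_pos.2 hk0) (Int.natCast_dvd.1 (hpZ.dvd_of_dvd_pow h))
    omega
  · rcases hpZ.dvd_or_dvd h with h | h
    · exact hn h
    · have := Nat.le_of_dvd (Nat.pos_of_ne_zero hG) (Int.natCast_dvd_natCast.1 h)
      omega

lemma exists_galois_intermediateField {F E : Type*} [Field F] [CharZero F] [Field E]
    [IsAlgClosed E] [Algebra F E] (s : Finset E) (hs : ∀ a ∈ s, IsAlgebraic F a) :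
    ∃ L : IntermediateField F E, FiniteDimensional F L ∧ IsGalois F L ∧ ∀ a ∈ s, a ∈ L := by
  classical
  set q : Polynomial F := ∏ a ∈ s, minpoly F a with hq
  have := IntermediateField.adjoin_rootSet_isSplittingField
    (IsAlgClosed.splits (q.map (algebraMap F E)))
  have hfin := Polynomial.IsSplittingField.finiteDimensional
    (IntermediateField.adjoin F (q.rootSet E)) q
  have := Normal.of_isSplittingField (E := IntermediateField.adjoin F (q.rootSet E)) q
  refine ⟨IntermediateField.adjoin F (q.rootSet E), hfin, ⟨⟩, fun a ha => ?_⟩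
  refine IntermediateField.subset_adjoin _ _ ((Polynomial.mem_rootSet).2 ⟨?_, ?_⟩)
  · exact Finset.prod_ne_zero_iff.2 fun b hb => minpoly.ne_zero (hs b hb).isIntegral
  · rw [hq, map_prod]
    exact Finset.prod_eq_zero ha (minpoly.aeval F a)

open scoped AddMonoidAlgebra in
/-- **Lindemann–Weierstrass theorem**: exponentials of distinct algebraic numbers are linearly
independent over the algebraic numbers. -/
theorem lindemann_weierstrass {ι : Type*} (s : Finset ι) (α β : ι → ℂ)
    (hα : ∀ i ∈ s, IsAlgebraic ℚ (α i)) (hβ : ∀ i ∈ s, IsAlgebraic ℚ (β i))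
    (hinj : Set.InjOn α s) (h : ∑ i ∈ s, β i * Complex.exp (α i) = 0) :
    ∀ i ∈ s, β i = 0 := by
  classical
  obtain ⟨L, hfin, hgal, hL⟩ := exists_galois_intermediateField (s.image α ∪ s.image β) (by
    intro a ha
    simp only [Finset.mem_union, Finset.mem_image] at ha
    rcases ha with ⟨i, hi, rfl⟩ | ⟨i, hi, rfl⟩
    exacts [hα i hi, hβ i hi])
  have : @IsGalois ℚ _ L _ DivisionRing.toRatAlgebra := by convert! hgal
  have hLα (i) (hi : i ∈ s) : α i ∈ L :=
    hL _ (Finset.mem_union_left _ (Finset.mem_image_of_mem _ hi))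
  have hLβ (i) (hi : i ∈ s) : β i ∈ L :=
    hL _ (Finset.mem_union_right _ (Finset.mem_image_of_mem _ hi))
  set x : L[L] := ∑ i ∈ s.attach, .single ⟨α i, hLα i i.2⟩ ⟨β i, hLβ i i.2⟩ with hx
  have hxE : expGroupAlgebra L x = 0 := by
    rw [hx, map_sum, ← h, ← Finset.sum_attach s]
    refine Finset.sum_congr rfl fun i _ => ?_
    simp [expGroupAlgebra, Algebra.smul_def]
  have hx0 : x = 0 := by
    by_contra hne
    obtain ⟨y, hyE, hy0, hyinv⟩ := exists_galois_invariant_of_expGroupAlgebra_eq_zero hne hxE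
    exact expGroupAlgebra_ne_zero_of_galois_invariant Fintype.card_ne_zero hy0 hyinv hyE
  intro i hi
  have hc : x.coeff ⟨α i, hLα i hi⟩ = ⟨β i, hLβ i hi⟩ := by
    rw [hx, AddMonoidAlgebra.coeff_sum, Finsupp.finsetSum_apply,
      Finset.sum_eq_single (⟨i, hi⟩ : {j // j ∈ s})]
    · simp
    · intro j _ hj
      rw [AddMonoidAlgebra.coeff_single, Finsupp.single_apply, if_neg]
      exact fun heq => hj (Subtype.ext (hinj j.2 hi (congrArg Subtype.val heq)))
    · simp
  rw [hx0] at hc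
  exact (congrArg Subtype.val hc).symm

lemma substX_eq_sum {n : ℕ} (P : MvPolynomial (Fin n ⊕ Fin n) ℝ) (x : Fin n → ℝ) :
    substX P x = ∑ m ∈ P.support,
      MvPolynomial.monomial (Finsupp.equivFunOnFinite.symm fun i => m (Sum.inr i))
        (P.coeff m * ∏ i, x i ^ m (Sum.inl i)) := by
  rw [substX, MvPolynomial.aeval_def, MvPolynomial.eval₂_eq']
  refine Finset.sum_congr rfl fun m _ => ?_
  rw [Fintype.prod_sum_type, MvPolynomial.monomial_eq, MvPolynomial.C_mul, mul_assoc,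
    Finsupp.prod_fintype _ _ (by simp)]
  simp [MvPolynomial.algebraMap_eq]

/-- Lindemann–Weierstrass type statement: if `x` has algebraic coordinates, `Q := P(x, U)`
is not identically zero and `Q(e^{x₁},…,e^{xₙ}) = 0`, then `x ∈ W_P`. -/
theorem stmt10 (n : ℕ) (K : Subfield ℝ) (hK : RealAlgExt K)
    (P : MvPolynomial (Fin n ⊕ Fin n) ℝ) (hP : CoeffsIn K P)
    (x : Fin n → ℝ) (halg : ∀ i, IsAlgebraic ℚ (x i))
    (hQ : substX P x ≠ 0)
    (hz : MvPolynomial.eval (fun i => Real.exp (x i)) (substX P x) = 0) :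
    ∃ d e : Fin n → ℕ, d ∈ Uexps P ∧ e ∈ Uexps P ∧ d ≠ e ∧
      ∑ i, (d i : ℝ) * x i = ∑ i, (e i : ℝ) * x i := by
  classical
  by_contra! hne
  set Q := substX P x with hQdef
  have hexp (d : Fin n →₀ ℕ) (hd : d ∈ Q.support) : (d : Fin n → ℕ) ∈ Uexps P := by
    rw [hQdef, substX_eq_sum] at hd
    obtain ⟨m, hm, hd⟩ := Finset.mem_biUnion.1 (MvPolynomial.support_sum hd)
    rw [Finset.mem_singleton.1 (MvPolynomial.support_monomial_subset hd)]
    exact ⟨m, hm, by simp⟩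
  have hcoeff (d : Fin n →₀ ℕ) : IsAlgebraic ℚ (Q.coeff d) := by
    rw [hQdef, substX_eq_sum, MvPolynomial.coeff_sum]
    refine (IsIntegral.sum _ fun m _ => IsAlgebraic.isIntegral ?_).isAlgebraic
    rw [MvPolynomial.coeff_monomial]
    split_ifs
    · exact (hK ⟨_, hP m⟩).mul (IsIntegral.prod _ fun i _ =>
        ((halg i).pow _).isIntegral).isAlgebraic
    · exact isAlgebraic_zero
  have hexponent (d : Fin n →₀ ℕ) : IsAlgebraic ℚ (∑ i, (d i : ℝ) * x i) :=
    (IsIntegral.sum _ fun i _ =>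
      ((isAlgebraic_natCast (d i)).mul (halg i)).isIntegral).isAlgebraic
  have hzero := lindemann_weierstrass Q.support
    (fun d => ((∑ i, (d i : ℝ) * x i : ℝ) : ℂ)) (fun d => ((Q.coeff d : ℝ) : ℂ))
    (fun d _ => (hexponent d).algebraMap)
    (fun d _ => (hcoeff d).algebraMap)
    (fun d hd e he hde => by
      by_contra h
      exact hne d e (hexp d hd) (hexp e he) (fun h' => h (DFunLike.coe_injective h'))
        (Complex.ofReal_injective hde))
    (by
      rw [MvPolynomial.eval_eq'] at hz
      rw [← Complex.ofReal_zero, ← hz, Complex.ofReal_sum]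
      refine Finset.sum_congr rfl fun d _ => ?_
      rw [← Complex.ofReal_exp, ← Complex.ofReal_mul, Real.exp_sum]
      simp [← Real.exp_nat_mul])
  obtain ⟨d, hd⟩ := MvPolynomial.support_nonempty.2 hQ
  exact MvPolynomial.mem_support_iff.1 hd (by exact_mod_cast hzero d hd)

end
end
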